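/- arXiv:2509.06935 — 2 statements merged into one kernel-verified Lean document; each statement's English description precedes it below -/
import Mathlib

section
/- There exists N ∈ ℕ such that for every n ≥ N there is a subset S of [n]^2 with |S| ≥ 7n/12 such that no four points of S lie on a common line and no four points of S lie on a common circle. -/
/-- The grid `[n]^2`: points of `ℝ^2` with both coordinates integers in `{1, …, n}`. -/
def grid (n : ℕ) : Set (EuclideanSpace ℝ (Fin 2)) :=
  {x | ∀ i, ∃ m : ℕ, 1 ≤ m ∧ m ≤ n ∧ x i = (m : ℝ)}

section
open ArithmeticFunction

/-- number of `j < n` with `d ∣ 4 j + a` -/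
def cnt4 (a n d : ℕ) : ℕ := ((Finset.range n).filter (fun j => d ∣ 4 * j + a)).card

noncomputable def psi4 (a N : ℕ) : ℝ :=
  ∑ d ∈ Finset.range (N + 1), if d % 4 = a then vonMangoldt d else 0

noncomputable def evenPart (n : ℕ) : ℝ :=
  ∑ d ∈ Finset.range (4 * n + 1), if d % 2 = 0 then vonMangoldt d * ((n / d : ℕ) : ℝ) else 0

noncomputable def mainB (a n : ℕ) : ℝ :=
  ∑ d ∈ Finset.range (4 * n + 1),
    if d % 2 = 1 then vonMangoldt d * ((cnt4 a n d : ℝ) - ((n / d : ℕ) : ℝ)) else 0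

theorem cnt4_bounds (a n d : ℕ) (hd : d % 2 = 1) :
    n / d ≤ cnt4 a n d ∧ cnt4 a n d ≤ n / d + 1 := by
  have hc : Nat.Coprime 4 d := by
    have : Nat.Coprime (2^2) d := Nat.Coprime.pow_left 2 ((Nat.coprime_two_left).2 (Nat.odd_iff.2 hd))
    simpa using this
  have hdpos : 0 < d := by omega
  obtain ⟨v, hv⟩ : ∃ v : ℕ, d ∣ 4 * v + a := by
    have hu : IsUnit ((4 : ℕ) : ZMod d) := (ZMod.isUnit_iff_coprime 4 d).2 hc
    obtain ⟨u, hu⟩ := hu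
    have : NeZero d := ⟨by omega⟩
    refine ⟨((-(a : ZMod d)) * (u⁻¹ : (ZMod d)ˣ)).val, ?_⟩
    rw [← ZMod.natCast_eq_zero_iff]
    push_cast
    rw [ZMod.natCast_zmod_val]
    have h4 : (4 : ZMod d) = u := by rw [hu]; simp
    rw [h4]
    have := u.mul_inv
    linear_combination (-(a : ZMod d)) * this
  have key : cnt4 a n d = n.count (· ≡ v [MOD d]) := by
    rw [Nat.count_eq_card_filter_range, cnt4]
    congr 1
    apply Finset.filter_congr
    intro j _
    constructor
    · intro h
      have h1 : 4 * j + a ≡ 4 * v + a [MOD d] :=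
        ((Nat.modEq_zero_iff_dvd).2 h).trans ((Nat.modEq_zero_iff_dvd).2 hv).symm
      exact Nat.ModEq.cancel_left_of_coprime (by simpa [Nat.coprime_comm] using hc) (Nat.ModEq.add_right_cancel' a h1)
    · intro h
      have h1 : 4 * j + a ≡ 4 * v + a [MOD d] := (h.mul_left 4).add_right a
      exact (Nat.modEq_zero_iff_dvd).1 (h1.trans ((Nat.modEq_zero_iff_dvd).2 hv))
  rw [key, Nat.count_modEq_card _ hdpos]
  split_ifs <;> omega

theorem log_sum_dvd (m M : ℕ) (hm : 0 < m) (hM : m ≤ M) :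
    Real.log m = ∑ d ∈ Finset.range (M + 1), if d ∣ m then vonMangoldt d else 0 := by
  rw [← vonMangoldt_sum, ← Finset.sum_filter]
  apply Finset.sum_subset_zero_on_sdiff
  · intro d hd
    have := Nat.divisor_le hd
    simp at hd ⊢
    exact ⟨by omega, hd.1⟩
  · intro x hx
    simp at hx
    omega
  · intros; rfl

theorem sum_log4 (a n : ℕ) (ha : a % 2 = 1) (ha' : a < 4) :
    ∑ j ∈ Finset.range n, Real.log ((4 * j + a : ℕ) : ℝ) =
      ∑ d ∈ Finset.range (4 * n + 1), if d % 2 = 1 then vonMangoldt d * (cnt4 a n d : ℝ) else 0 := by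
  have h1 : ∀ j ∈ Finset.range n, Real.log ((4 * j + a : ℕ) : ℝ) =
      ∑ d ∈ Finset.range (4 * n + 1), if d ∣ 4 * j + a then vonMangoldt d else 0 := by
    intro j hj
    have := Finset.mem_range.1 hj
    exact log_sum_dvd _ _ (by omega) (by omega)
  rw [Finset.sum_congr rfl h1, Finset.sum_comm]
  apply Finset.sum_congr rfl
  intro d _
  rw [← Finset.sum_filter, Finset.sum_const, nsmul_eq_mul, mul_comm]
  split_ifs with h
  · rfl
  · have : (Finset.range n).filter (fun j => d ∣ 4 * j + a) = ∅ := by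
      apply Finset.filter_false_of_mem
      intro j _ hdj
      have : 2 ∣ 4 * j + a := dvd_trans (by omega) hdj
      omega
    rw [this]; simp

theorem sum_logfact (n : ℕ) :
    ∑ j ∈ Finset.range n, Real.log ((j + 1 : ℕ) : ℝ) =
      ∑ d ∈ Finset.range (4 * n + 1), vonMangoldt d * ((n / d : ℕ) : ℝ) := by
  have h1 : ∀ j ∈ Finset.range n, Real.log ((j + 1 : ℕ) : ℝ) =
      ∑ d ∈ Finset.range (4 * n + 1), if d ∣ j + 1 then vonMangoldt d else 0 := by
    intro j hj
    have := Finset.mem_range.1 hj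
    exact log_sum_dvd _ _ (by omega) (by omega)
  rw [Finset.sum_congr rfl h1, Finset.sum_comm]
  apply Finset.sum_congr rfl
  intro d _
  rw [← Finset.sum_filter, Finset.sum_const, nsmul_eq_mul, mul_comm]
  congr 2
  rw [← Nat.card_multiples n d]

theorem mainB_eq (a n : ℕ) (ha : a % 2 = 1) (ha' : a < 4) :
    mainB a n = ∑ j ∈ Finset.range n, Real.log ((4 * j + a : ℕ) : ℝ)
      - ∑ j ∈ Finset.range n, Real.log ((j + 1 : ℕ) : ℝ) + evenPart n := by
  rw [sum_log4 a n ha ha', sum_logfact, mainB, evenPart, ← Finset.sum_sub_distrib,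
    ← Finset.sum_add_distrib]
  apply Finset.sum_congr rfl
  intro d _
  rcases Nat.mod_two_eq_zero_or_one d with h | h <;> simp [h]
  ring

theorem evenPart_eq (n : ℕ) : evenPart n = Real.log 2 * (padicValNat 2 n.factorial : ℝ) := by
  have : Fact (Nat.Prime 2) := ⟨Nat.prime_two⟩
  rw [padicValNat_factorial (b := Nat.log 2 (4 * n + 1) + 1)
    (Nat.lt_succ_of_le (Nat.log_mono_right (by omega))), evenPart, Nat.cast_sum, Finset.mul_sum]
  symm
  rw [← Finset.sum_filter]
  have hinj : Set.InjOn (fun k : ℕ => 2 ^ k) (Finset.Ico 1 (Nat.log 2 (4 * n + 1) + 1) : Set ℕ) :=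
    fun a _ b _ h => Nat.pow_right_injective le_rfl h
  have e : ∀ k ∈ Finset.Ico 1 (Nat.log 2 (4 * n + 1) + 1), Real.log 2 * ((n / 2 ^ k : ℕ) : ℝ) =
      vonMangoldt (2 ^ k) * ((n / 2 ^ k : ℕ) : ℝ) := by
    intro k hk
    rw [vonMangoldt_apply_pow (by simp at hk; omega), vonMangoldt_apply_prime Nat.prime_two]
    simp
  rw [Finset.sum_congr rfl e, ← Finset.sum_image (s := Finset.Ico 1 (Nat.log 2 (4 * n + 1) + 1))
    (g := fun k => 2 ^ k) (f := fun d => vonMangoldt d * ((n / d : ℕ) : ℝ)) hinj]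
  have hz : ∀ d, d % 2 = 0 → vonMangoldt d ≠ 0 → ∃ k, 1 ≤ k ∧ d = 2 ^ k := by
    intro d hd hv
    obtain ⟨p, k, hp, hk, rfl⟩ := (isPrimePow_nat_iff d).1 (vonMangoldt_ne_zero_iff.1 hv)
    have : 2 ∣ p := Nat.prime_two.dvd_of_dvd_pow (Nat.dvd_of_mod_eq_zero hd)
    have := (Nat.prime_dvd_prime_iff_eq Nat.prime_two hp).1 this
    subst this
    exact ⟨k, hk, rfl⟩
  apply Finset.sum_congr_of_eq_on_inter
  · intro d hd hd'
    exfalso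
    obtain ⟨k, hk, rfl⟩ := Finset.mem_image.1 hd
    obtain ⟨hk1, hk2⟩ := Finset.mem_Ico.1 hk
    apply hd'
    have hle : 2 ^ k ≤ 4 * n + 1 := Nat.pow_le_of_le_log (by omega) (by omega)
    have hev : 2 ∣ 2 ^ k := dvd_pow_self 2 (by omega)
    simp only [Finset.mem_filter, Finset.mem_range]
    omega
  · intro d hd hd'
    by_contra hne
    obtain ⟨k, hk, rfl⟩ := hz d (by simp at hd; exact hd.2) (left_ne_zero_of_mul hne)
    apply hd'
    simp only [Finset.mem_filter, Finset.mem_range] at hd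
    rw [Finset.mem_image]
    refine ⟨k, ?_, rfl⟩
    rw [Finset.mem_Ico]
    refine ⟨hk, Nat.lt_succ_of_le ?_⟩
    exact Nat.le_log_of_pow_le (by norm_num) (by omega)
  · intros; rfl

theorem evenPart_le (n : ℕ) : evenPart n ≤ n * Real.log 2 := by
  have : Fact (Nat.Prime 2) := ⟨Nat.prime_two⟩
  rw [evenPart_eq, mul_comm]
  have h := sub_one_mul_padicValNat_factorial (p := 2) n
  have : padicValNat 2 n.factorial ≤ n := by
    simp at h; omega
  have h2 := Real.log_nonneg (x := 2) (by norm_num)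
  gcongr

theorem evenPart_ge (n : ℕ) : ((n : ℝ) - (Nat.log 2 n + 1 : ℕ)) * Real.log 2 ≤ evenPart n := by
  have : Fact (Nat.Prime 2) := ⟨Nat.prime_two⟩
  rw [evenPart_eq, mul_comm]
  have h := sub_one_mul_padicValNat_factorial (p := 2) n
  have h1 : (Nat.digits 2 n).sum ≤ Nat.log 2 n + 1 := by
    rcases Nat.eq_zero_or_pos n with rfl | hn
    · simp
    have := List.sum_le_card_nsmul (Nat.digits 2 n) 1 (by
      intro x hx
      have := Nat.digits_lt_base (by norm_num) hx
      omega)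
    rw [Nat.length_digits 2 n (by norm_num) (by omega)] at this
    simpa using this
  have : n ≤ padicValNat 2 n.factorial + (Nat.log 2 n + 1) := by
    simp at h; omega
  have h2 := Real.log_nonneg (x := 2) (by norm_num)
  have h3 : (n : ℝ) ≤ padicValNat 2 n.factorial + (Nat.log 2 n + 1 : ℕ) := by exact_mod_cast this
  apply mul_le_mul_of_nonneg_left _ h2
  linarith

theorem mainB_le (a n : ℕ) (ha : a % 2 = 1) (ha' : a < 4) : mainB a n ≤ 3 * n * Real.log 2 := by
  rw [mainB_eq a n ha ha', ← Finset.sum_sub_distrib]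
  have h1 : ∑ j ∈ Finset.range n, (Real.log ((4 * j + a : ℕ) : ℝ) - Real.log ((j + 1 : ℕ) : ℝ))
      ≤ ∑ j ∈ Finset.range n, (2 * Real.log 2) := by
    apply Finset.sum_le_sum
    intro j _
    have e : (2 * Real.log 2) = Real.log 4 := by
      rw [show (4:ℝ) = 2 ^ 2 by norm_num, Real.log_pow]; norm_num
    rw [e, sub_le_iff_le_add, ← Real.log_mul (by norm_num) (by positivity)]
    apply Real.log_le_log
    · exact_mod_cast (by omega : 0 < 4 * j + a)
    · exact_mod_cast (by omega : 4 * j + a ≤ 4 * (j + 1))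
  have h2 := evenPart_le n
  rw [Finset.sum_const, Finset.card_range, nsmul_eq_mul] at h1
  linarith

theorem mainB_ge (n : ℕ) (hn : 1 ≤ n) :
    3 * n * Real.log 2 - (Real.log n + 2 * Real.log 2 + (Nat.log 2 n + 1 : ℕ) * Real.log 2)
      ≤ mainB 1 n := by
  rw [mainB_eq 1 n (by norm_num) (by norm_num)]
  obtain ⟨m, rfl⟩ : ∃ m, n = m + 1 := ⟨n - 1, by omega⟩
  rw [Finset.sum_range_succ' (fun j => Real.log ((4 * j + 1 : ℕ) : ℝ)),
    Finset.sum_range_succ (fun j => Real.log ((j + 1 : ℕ) : ℝ))]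
  have h1 : ∑ j ∈ Finset.range m, (2 * Real.log 2) ≤ ∑ j ∈ Finset.range m, (Real.log ((4 * (j + 1) + 1 : ℕ) : ℝ) - Real.log ((j + 1 : ℕ) : ℝ)) := by
    apply Finset.sum_le_sum
    intro j _
    have e : (2 * Real.log 2) = Real.log 4 := by
      rw [show (4:ℝ) = 2 ^ 2 by norm_num, Real.log_pow]; norm_num
    rw [e, le_sub_iff_add_le, ← Real.log_mul (by norm_num) (by positivity)]
    apply Real.log_le_log
    · positivity
    · exact_mod_cast (by omega : 4 * (j + 1) ≤ 4 * (j + 1) + 1)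
  have h2 := evenPart_ge (m + 1)
  rw [Finset.sum_sub_distrib] at h1
  rw [Finset.sum_const, Finset.card_range, nsmul_eq_mul] at h1
  have h0 : Real.log ((4 * 0 + 1 : ℕ) : ℝ) = 0 := by simp
  rw [h0]
  push_cast at *
  linarith

theorem psi4_step (a n : ℕ) (ha : a % 2 = 1) (ha' : a < 4) :
    psi4 a (4 * n) ≤ psi4 a n + 3 * n * Real.log 2 := by
  have h := mainB_le a n ha ha'
  have hp : psi4 a n = ∑ d ∈ Finset.range (4 * n + 1),
      if d % 4 = a ∧ d ≤ n then vonMangoldt d else 0 := by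
    rw [psi4, ← Finset.sum_filter, ← Finset.sum_filter]
    apply Finset.sum_congr _ (fun _ _ => rfl)
    ext d; simp; omega
  suffices psi4 a (4 * n) ≤ psi4 a n + mainB a n by linarith
  rw [hp, psi4, mainB, ← Finset.sum_add_distrib]
  apply Finset.sum_le_sum
  intro d hd
  have hΛ : 0 ≤ vonMangoldt d := vonMangoldt_nonneg
  have hd := Finset.mem_range.1 hd
  by_cases h1 : d % 2 = 1
  · have hb := (cnt4_bounds a n d h1).1
    have hb' : ((n / d : ℕ) : ℝ) ≤ cnt4 a n d := by exact_mod_cast hb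
    by_cases h2 : d % 4 = a
    · by_cases h3 : d ≤ n
      · simp only [h1, h2, h3, if_true, and_self]
        nlinarith
      · simp only [h1, h2, h3, if_true, and_false, if_false]
        rw [Nat.div_eq_of_lt (by omega)]
        have : 1 ≤ cnt4 a n d := by
          rw [cnt4, Nat.one_le_iff_ne_zero, ← Nat.pos_iff_ne_zero, Finset.card_pos]
          exact ⟨d / 4, by simp; constructor
                           · omega
                           · rw [show 4 * (d / 4) + a = d by omega]⟩
        have : (1 : ℝ) ≤ cnt4 a n d := by exact_mod_cast this
        push_cast
        nlinarith
    · simp only [h1, h2, if_true, false_and, if_false]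
      nlinarith
  · have h2 : d % 4 ≠ a := by omega
    simp [h1, h2]

theorem psi4_lower (n : ℕ) :
    mainB 1 n ≤ psi4 1 (4 * n) + psi4 3 (4 * n / 3) := by
  have hp : psi4 3 (4 * n / 3) = ∑ d ∈ Finset.range (4 * n + 1),
      if d % 4 = 3 ∧ d ≤ 4 * n / 3 then vonMangoldt d else 0 := by
    rw [psi4, ← Finset.sum_filter, ← Finset.sum_filter]
    apply Finset.sum_congr _ (fun _ _ => rfl)
    ext d; simp; omega
  rw [hp, psi4, mainB, ← Finset.sum_add_distrib]
  apply Finset.sum_le_sum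
  intro d hd
  have hΛ : 0 ≤ vonMangoldt d := vonMangoldt_nonneg
  by_cases h1 : d % 2 = 1
  · have hb := (cnt4_bounds 1 n d h1).2
    have hb' : (cnt4 1 n d : ℝ) ≤ ((n / d : ℕ) : ℝ) + 1 := by exact_mod_cast hb
    have hle : vonMangoldt d * ((cnt4 1 n d : ℝ) - ((n / d : ℕ) : ℝ)) ≤ vonMangoldt d := by
      nlinarith
    rcases (by omega : d % 4 = 1 ∨ d % 4 = 3) with h2 | h2
    · simp [h1, h2]; simpa using hle
    · by_cases h3 : d ≤ 4 * n / 3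
      · simp [h1, h2, h3]; simpa using hle
      · simp only [h1, h2, h3, if_true, and_false, if_false]
        have : cnt4 1 n d = 0 := by
          rw [cnt4, Finset.card_eq_zero]
          apply Finset.filter_false_of_mem
          rintro j hj ⟨m, hm⟩
          have hj := Finset.mem_range.1 hj
          have hm4 : (4 * j + 1) % 4 = (d % 4) * (m % 4) % 4 := by rw [hm, Nat.mul_mod]
          rw [h2] at hm4
          have : 3 ≤ m := by
            have := Nat.mod_le m 4
            have := Nat.mod_lt m (by norm_num : 0 < 4)
            omega
          have : d * 3 ≤ d * m := Nat.mul_le_mul_left d this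
          omega
        rw [this]
        have : (0 : ℝ) ≤ ((n / d : ℕ) : ℝ) := by positivity
        norm_num
        positivity
  · have h2 : d % 4 ≠ 1 := by omega
    have h3 : d % 4 ≠ 3 := by omega
    simp [h1, h2, h3]

theorem psi4_mono (a : ℕ) : Monotone (psi4 a) := by
  intro m n h
  apply Finset.sum_le_sum_of_subset_of_nonneg
  · intro x hx; simp at hx ⊢; omega
  · intro d _ _
    split_ifs
    · exact vonMangoldt_nonneg
    · exact le_rfl

theorem psi4_upper (a : ℕ) (ha : a % 2 = 1) (ha' : a < 4) :
    ∃ K : ℝ, ∀ N : ℕ, psi4 a N ≤ 0.7 * N + K := by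
  obtain ⟨T, hT⟩ : ∃ T : ℕ, T = 500 := ⟨_, rfl⟩
  refine ⟨psi4 a T, fun N => ?_⟩
  induction N using Nat.strong_induction_on with
  | _ N ih =>
    rcases le_or_gt N T with h | h
    · have := psi4_mono a h
      have h0 : (0 : ℝ) ≤ N := by positivity
      linarith
    · have h1 := ih ((N + 3) / 4) (by omega)
      have h2 := psi4_step a ((N + 3) / 4) ha ha'
      have h3 : psi4 a N ≤ psi4 a (4 * ((N + 3) / 4)) := psi4_mono a (by omega)
      have h4 : (((N + 3) / 4 : ℕ) : ℝ) ≤ (N + 3) / 4 := by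
        rw [le_div_iff₀ (by norm_num)]
        exact_mod_cast (by omega : (N + 3) / 4 * 4 ≤ N + 3)
      have h5 := Real.log_two_lt_d9
      have h6 : (500 : ℝ) < N := by exact_mod_cast hT ▸ h
      have h7 : (0 : ℝ) ≤ (((N + 3) / 4 : ℕ) : ℝ) := by positivity
      nlinarith

theorem exists_prime4 : ∃ M0 : ℕ, ∀ M ≥ M0, ∃ p : ℕ, p.Prime ∧ p % 4 = 1 ∧
    7 * M ≤ 12 * p ∧ 7 * p ≤ 12 * M := by
  obtain ⟨K1, hK1⟩ := psi4_upper 1 (by norm_num) (by norm_num)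
  obtain ⟨K3, hK3⟩ := psi4_upper 3 (by norm_num) (by norm_num)
  obtain ⟨C, hC⟩ := Chebyshev.psi_sub_theta_le_mul_sqrt
  set A : ℝ := 2 * |C| + 4 + |K1| + |K3| + 10 with hA
  refine ⟨⌈(A / 0.07 + 1) ^ 2⌉₊ + 10, fun M hM => ?_⟩
  by_contra hno
  push Not at hno
  set k := 3 * M / 7 with hk
  set y := 7 * M / 12 with hy
  have hk1 : 1 ≤ k := by omega
  have hyk : y ≤ 4 * k := by omega
  -- difference bounded by prime powers
  have hdiff : psi4 1 (4 * k) ≤ psi4 1 y + C * Real.sqrt ((4 * k : ℕ) : ℝ) := by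
    refine le_trans ?_ (add_le_add_right (hC ((4 * k : ℕ) : ℝ)) _)
    rw [Chebyshev.psi_sub_theta_eq_sum_not_prime, Nat.floor_natCast]
    have e1 : psi4 1 y = ∑ d ∈ Finset.range (4 * k + 1),
        if d % 4 = 1 ∧ d ≤ y then vonMangoldt d else 0 := by
      rw [psi4, ← Finset.sum_filter, ← Finset.sum_filter]
      apply Finset.sum_congr _ (fun _ _ => rfl)
      ext d; simp; omega
    have e2 : ∑ d ∈ Finset.Ioc 0 (4 * k) with ¬ d.Prime, vonMangoldt d =
        ∑ d ∈ Finset.range (4 * k + 1), if ¬ d.Prime then vonMangoldt d else 0 := by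
      rw [← Finset.sum_filter]
      apply Finset.sum_subset
      · intro d hd
        simp only [Finset.mem_filter, Finset.mem_Ioc, Finset.mem_range] at hd ⊢
        exact ⟨by omega, hd.2⟩
      · intro d hd hd'
        have : d = 0 := by
          simp at hd hd'
          by_contra h0
          exact hd.2 (hd' (by omega) (by omega))
        simp [this]
    rw [e1, e2, psi4, ← Finset.sum_add_distrib]
    apply Finset.sum_le_sum
    intro d hd
    have hd := Finset.mem_range.1 hd
    have hΛ : 0 ≤ vonMangoldt d := vonMangoldt_nonneg
    by_cases h1 : d % 4 = 1
    · by_cases h2 : d ≤ y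
      · simp only [h1, h2, and_self, if_true]
        split_ifs <;> linarith
      · have : ¬ d.Prime := by
          intro hp
          have := hno d hp h1 (by omega)
          omega
        simp [h1, h2, this]
    · simp only [h1, false_and, if_false]
      split_ifs <;> linarith
  have hlow := psi4_lower k
  have hB := mainB_ge k hk1
  have h3 := hK3 (4 * k / 3)
  have h1 := hK1 y
  set s := Real.sqrt M with hs
  have hs2 : s * s = M := Real.mul_self_sqrt (by positivity)
  have hs0 : 0 ≤ s := Real.sqrt_nonneg _
  have hkM : k ≤ M := by omega
  have hkR : (k : ℝ) ≤ M := by exact_mod_cast hkM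
  have hk0 : (1 : ℝ) ≤ k := by exact_mod_cast hk1
  have hsq : Real.sqrt ((4 * k : ℕ) : ℝ) ≤ 2 * s := by
    rw [Real.sqrt_le_left (by positivity)]
    push_cast
    nlinarith
  have hsk : Real.sqrt k ≤ s := Real.sqrt_le_sqrt hkR
  have hlog : Real.log k ≤ 2 * s := by
    have := Real.log_le_sub_one_of_pos (x := Real.sqrt k) (by positivity)
    rw [Real.log_sqrt (by positivity)] at this
    linarith
  have hnlog : (Nat.log 2 k : ℝ) * Real.log 2 ≤ Real.log k := by
    rw [← Real.log_pow]
    apply Real.log_le_log (by positivity)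
    exact_mod_cast Nat.pow_log_le_self 2 (by omega)
  have hl1 := Real.log_two_gt_d9
  have hl2 := Real.log_two_lt_d9
  have h43 : ((4 * k / 3 : ℕ) : ℝ) ≤ 4 * k / 3 := by
    rw [le_div_iff₀ (by norm_num)]
    exact_mod_cast (by omega : 4 * k / 3 * 3 ≤ 4 * k)
  have hyR : (y : ℝ) ≤ 7 * M / 12 := by
    rw [le_div_iff₀ (by norm_num)]
    exact_mod_cast (by omega : y * 12 ≤ 7 * M)
  have hkge : (3 * M - 6) / 7 ≤ (k : ℝ) := by
    rw [div_le_iff₀ (by norm_num), sub_le_iff_le_add]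
    exact_mod_cast (by omega : 3 * M ≤ k * 7 + 6)
  have hsbig : A / 0.07 + 1 ≤ s := by
    apply Real.le_sqrt_of_sq_le
    have h := Nat.le_ceil ((A / 0.07 + 1) ^ 2)
    have : ((⌈(A / 0.07 + 1) ^ 2⌉₊ : ℕ) : ℝ) ≤ M := by exact_mod_cast (by omega)
    linarith
  have hA0 : 0 ≤ A := by positivity
  have hs1 : 1 ≤ s := le_trans (by linarith [show 0 ≤ A / 0.07 by positivity]) hsbig
  have hAs : A < 0.07 * s := by
    have : A / 0.07 < s := by linarith
    rw [div_lt_iff₀ (by norm_num)] at this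
    linarith
  have hCs : C * Real.sqrt ((4 * k : ℕ) : ℝ) ≤ 2 * |C| * s := by
    calc _ ≤ |C| * Real.sqrt ((4 * k : ℕ) : ℝ) := by gcongr; exact le_abs_self C
      _ ≤ |C| * (2 * s) := by gcongr
      _ = _ := by ring
  have hK1' : K1 ≤ |K1| * s := le_trans (le_abs_self _) (le_mul_of_one_le_right (abs_nonneg _) hs1)
  have hK3' : K3 ≤ |K3| * s := le_trans (le_abs_self _) (le_mul_of_one_le_right (abs_nonneg _) hs1)
  push_cast at hB hkge
  have hkl : 2.079 * (k : ℝ) ≤ 3 * k * Real.log 2 := by nlinarith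
  have hfin : A * s < 0.07 * M := by
    rw [← hs2]; nlinarith
  have hAexp : A * s = 2 * |C| * s + 4 * s + |K1| * s + |K3| * s + 10 * s := by rw [hA]; ring
  nlinarith

end

/-- 3x3 determinant of rows `(a i, b i, c i)` minus row 0. -/
def det4 {R : Type*} [CommRing R] (a b c : Fin 4 → R) : R :=
  (a 1 - a 0) * ((b 2 - b 0) * (c 3 - c 0) - (b 3 - b 0) * (c 2 - c 0))
  - (a 2 - a 0) * ((b 1 - b 0) * (c 3 - c 0) - (b 3 - b 0) * (c 1 - c 0))
  + (a 3 - a 0) * ((b 1 - b 0) * (c 2 - c 0) - (b 2 - b 0) * (c 1 - c 0))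

theorem det4_parab {R : Type*} [CommRing R] (I w : R) (hI : I * I = -1) (x y : Fin 4 → R)
    (h : ∀ k, (x k - I * y k) - (x k + I * y k) ^ 2 = w) :
    (-(2 * I)) * det4 (fun k => x k ^ 2 + y k ^ 2) x y =
      ((x 1 + I * y 1) - (x 0 + I * y 0)) * ((x 2 + I * y 2) - (x 0 + I * y 0)) *
      ((x 3 + I * y 3) - (x 0 + I * y 0)) * ((x 2 + I * y 2) - (x 1 + I * y 1)) *
      ((x 3 + I * y 3) - (x 1 + I * y 1)) * ((x 3 + I * y 3) - (x 2 + I * y 2)) := by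
  obtain ⟨u, hu⟩ : ∃ u : Fin 4 → R, ∀ k, u k = x k + I * y k := ⟨_, fun _ => rfl⟩
  obtain ⟨v, hv⟩ : ∃ v : Fin 4 → R, ∀ k, v k = x k - I * y k := ⟨_, fun _ => rfl⟩
  have hN : ∀ k, x k ^ 2 + y k ^ 2 = u k * v k := by
    intro k; rw [hu, hv]; linear_combination (y k)^2 * hI
  have hv' : ∀ k, v k = u k ^ 2 + w := by
    intro k; rw [hu, hv, ← h k]; ring
  have e : ∀ N : Fin 4 → R, (-(2 * I)) * det4 N x y = det4 N u v := by
    intro N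
    simp only [det4, hu, hv]
    ring
  rw [e]
  simp only [← hu]
  simp only [hN, hv', det4]
  ring

theorem det4_cast {R : Type*} [CommRing R] (a b c : Fin 4 → ℤ) :
    ((det4 a b c : ℤ) : R) = det4 (fun k => (a k : R)) (fun k => (b k : R)) (fun k => (c k : R)) := by
  simp [det4]

theorem four_of_ncard {α : Type*} {s : Set α} (h : ¬ s.ncard ≤ 3) :
    ∃ f : Fin 4 → α, Function.Injective f ∧ ∀ k, f k ∈ s := by
  obtain ⟨t, hts, ht⟩ := Set.exists_subset_card_eq (s := s) (n := 4) (by omega)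
  have hfin : t.Finite := Set.finite_of_ncard_ne_zero (by omega)
  have := hfin.fintype
  have hc : Fintype.card t = 4 := by rw [← ht, ← Nat.card_eq_fintype_card, Nat.card_coe_set_eq]
  let e := (Fintype.equivFinOfCardEq hc).symm
  exact ⟨fun k => (e k : α), fun a b hab => e.injective (Subtype.ext hab), fun k => hts (e k).2⟩

theorem construct (n p : ℕ) (hp : p.Prime) (hp4 : p % 4 = 1) :
    ∃ S : Set (EuclideanSpace ℝ (Fin 2)),
      S ⊆ grid n ∧ ((min n p : ℕ) : ℝ) ^ 2 ≤ p * S.ncard ∧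
      (∀ L : AffineSubspace ℝ (EuclideanSpace ℝ (Fin 2)),
        Module.finrank ℝ L.direction = 1 →
          (S ∩ (L : Set (EuclideanSpace ℝ (Fin 2)))).ncard ≤ 3) ∧
      (∀ (c : EuclideanSpace ℝ (Fin 2)) (ρ : ℝ), 0 < ρ →
          (S ∩ Metric.sphere c ρ).ncard ≤ 3) := by
  have : Fact p.Prime := ⟨hp⟩
  obtain ⟨I, hI⟩ := (ZMod.exists_sq_eq_neg_one_iff (p := p)).2 (by omega)
  have hI : I * I = -1 := hI.symm
  set m := min n p with hm
  let g : ℕ × ℕ → ZMod p := fun q => ((q.1 : ZMod p) - I * q.2) - ((q.1 : ZMod p) + I * q.2) ^ 2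
  let G : Finset (ℕ × ℕ) := Finset.Icc 1 m ×ˢ Finset.Icc 1 m
  obtain ⟨w, -, hw⟩ := Finset.exists_max_image (Finset.univ : Finset (ZMod p))
    (fun w => (G.filter (fun q => g q = w)).card) ⟨0, Finset.mem_univ _⟩
  set T := G.filter (fun q => g q = w) with hT
  have hcard : m ^ 2 ≤ p * T.card := by
    have h1 : G.card = ∑ w : ZMod p, (G.filter (fun q => g q = w)).card :=
      Finset.card_eq_sum_card_fiberwise (fun _ _ => Finset.mem_univ _)
    have h2 := Finset.sum_le_card_nsmul Finset.univ _ _ (fun w' _ => hw w' (Finset.mem_univ _))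
    rw [← h1, Finset.card_univ, ZMod.card] at h2
    simp [G] at h2
    rw [pow_two]; exact h2
  let φ : ℕ × ℕ → EuclideanSpace ℝ (Fin 2) := fun q => !₂[(q.1 : ℝ), (q.2 : ℝ)]
  have hφ0 : ∀ q, φ q 0 = q.1 := fun q => by simp [φ]
  have hφ1 : ∀ q, φ q 1 = q.2 := fun q => by simp [φ]
  have hφ : Function.Injective φ := by
    intro a b hab
    have h0 := hφ0 a; have h1 := hφ1 a
    rw [hab, hφ0] at h0; rw [hab, hφ1] at h1
    exact Prod.ext (Nat.cast_injective (R := ℝ) h0.symm) (Nat.cast_injective (R := ℝ) h1.symm)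
  -- key nonvanishing
  have key : ∀ q : Fin 4 → ℕ × ℕ, Function.Injective q → (∀ k, q k ∈ T) →
      det4 (fun k => ((q k).1 : ℝ) ^ 2 + ((q k).2 : ℝ) ^ 2) (fun k => ((q k).1 : ℝ))
        (fun k => ((q k).2 : ℝ)) ≠ 0 := by
    intro q hq hqT h0
    have hZ : det4 (fun k => ((q k).1 : ℤ) ^ 2 + ((q k).2 : ℤ) ^ 2) (fun k => ((q k).1 : ℤ))
        (fun k => ((q k).2 : ℤ)) = 0 := by
      have := det4_cast (R := ℝ) (fun k => ((q k).1 : ℤ) ^ 2 + ((q k).2 : ℤ) ^ 2)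
        (fun k => ((q k).1 : ℤ)) (fun k => ((q k).2 : ℤ))
      push_cast at this
      rw [h0] at this
      exact_mod_cast this
    have hP := det4_cast (R := ZMod p) (fun k => ((q k).1 : ℤ) ^ 2 + ((q k).2 : ℤ) ^ 2)
        (fun k => ((q k).1 : ℤ)) (fun k => ((q k).2 : ℤ))
    rw [hZ] at hP
    push_cast at hP
    have hg : ∀ k, g (q k) = w := fun k => (Finset.mem_filter.1 (hqT k)).2
    have hV := det4_parab I w hI (fun k => ((q k).1 : ZMod p)) (fun k => ((q k).2 : ZMod p)) hg
    rw [← hP, mul_zero] at hV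
    have hne : ∀ a b : Fin 4, a ≠ b →
        (((q a).1 : ZMod p) + I * (q a).2) - (((q b).1 : ZMod p) + I * (q b).2) ≠ 0 := by
      intro a b hab h
      apply hab
      apply hq
      have hu := sub_eq_zero.1 h
      have ga := hg a
      have gb := hg b
      simp only [g] at ga gb
      rw [hu] at ga
      have h2 : (2 : ZMod p) ≠ 0 := by
        intro h2
        have : ((2 : ℕ) : ZMod p) = 0 := by exact_mod_cast h2
        rw [ZMod.natCast_eq_zero_iff] at this
        have := Nat.le_of_dvd (by norm_num) this
        have := hp.two_le
        omega
      have hv : ((q a).1 : ZMod p) - I * (q a).2 = ((q b).1 : ZMod p) - I * (q b).2 := by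
        linear_combination ga - gb
      have hx : ((q a).1 : ZMod p) = (q b).1 := by
        apply mul_left_cancel₀ h2
        linear_combination hu + hv
      have hy : ((q a).2 : ZMod p) = (q b).2 := by
        apply mul_left_cancel₀ h2
        linear_combination (-I) * (hu - hv) + 2 * (((q a).2 : ZMod p) - (q b).2) * hI
      have inj : ∀ s t : ℕ, 1 ≤ s → s ≤ m → 1 ≤ t → t ≤ m → (s : ZMod p) = t → s = t := by
        intro s t hs1 hs2 ht1 ht2 hst
        rw [ZMod.natCast_eq_natCast_iff] at hst
        have hmp : m ≤ p := min_le_right _ _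
        have h3 : (s - 1) + 1 ≡ (t - 1) + 1 [MOD p] := by
          rwa [Nat.sub_add_cancel hs1, Nat.sub_add_cancel ht1]
        have h4 := Nat.ModEq.eq_of_lt_of_lt (Nat.ModEq.add_right_cancel' 1 h3) (by omega) (by omega)
        omega
      have ha := (Finset.mem_filter.1 (hqT a)).1
      have hb := (Finset.mem_filter.1 (hqT b)).1
      simp only [G, Finset.mem_product, Finset.mem_Icc] at ha hb
      exact Prod.ext (inj _ _ ha.1.1 ha.1.2 hb.1.1 hb.1.2 hx)
        (inj _ _ ha.2.1 ha.2.2 hb.2.1 hb.2.2 hy)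
    have := hV.symm
    simp only [mul_eq_zero] at this
    rcases this with ((((h | h) | h) | h) | h) | h
    · exact hne 1 0 (by decide) h
    · exact hne 2 0 (by decide) h
    · exact hne 3 0 (by decide) h
    · exact hne 2 1 (by decide) h
    · exact hne 3 1 (by decide) h
    · exact hne 3 2 (by decide) h
  -- extraction
  have ext : ∀ C : Set (EuclideanSpace ℝ (Fin 2)), ¬ ((φ '' (T : Set (ℕ × ℕ))) ∩ C).ncard ≤ 3 →
      ∃ q : Fin 4 → ℕ × ℕ, Function.Injective q ∧ (∀ k, q k ∈ T) ∧ ∀ k, φ (q k) ∈ C := by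
    intro C hC
    obtain ⟨f, hf, hfC⟩ := four_of_ncard hC
    choose q hq using fun k => (hfC k).1
    refine ⟨q, ?_, fun k => (hq k).1, fun k => by rw [(hq k).2]; exact (hfC k).2⟩
    intro a b hab
    apply hf
    rw [← (hq a).2, ← (hq b).2, hab]
  refine ⟨φ '' (T : Set (ℕ × ℕ)), ?_, ?_, ?_, ?_⟩
  · rintro _ ⟨q, hq, rfl⟩ i
    have ha := (Finset.mem_filter.1 hq).1
    simp only [G, Finset.mem_product, Finset.mem_Icc] at ha
    have hmn : m ≤ n := min_le_left _ _
    fin_cases i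
    · exact ⟨q.1, ha.1.1, ha.1.2.trans hmn, hφ0 q⟩
    · exact ⟨q.2, ha.2.1, ha.2.2.trans hmn, hφ1 q⟩
  · rw [Set.ncard_image_of_injective _ hφ, Set.ncard_coe_finset]
    exact_mod_cast hcard
  · intro L hL
    by_contra hC
    obtain ⟨q, hq, hqT, hqL⟩ := ext _ hC
    apply key q hq hqT
    obtain ⟨d, -, hd⟩ := finrank_eq_one_iff'.1 hL
    have hd' : ∀ k, ∃ t : ℝ, ((q k).1 : ℝ) - (q 0).1 = t * d.1 0 ∧
        ((q k).2 : ℝ) - (q 0).2 = t * d.1 1 := by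
      intro k
      obtain ⟨t, ht⟩ := hd ⟨φ (q k) -ᵥ φ (q 0), AffineSubspace.vsub_mem_direction (hqL k) (hqL 0)⟩
      have ht : t • d.1 = φ (q k) - φ (q 0) := congrArg Subtype.val ht
      refine ⟨t, ?_, ?_⟩
      · have := congrArg (fun v : EuclideanSpace ℝ (Fin 2) => v 0) ht
        simp only [PiLp.smul_apply, PiLp.sub_apply, hφ0, smul_eq_mul] at this
        exact this.symm
      · have := congrArg (fun v : EuclideanSpace ℝ (Fin 2) => v 1) ht
        simp only [PiLp.smul_apply, PiLp.sub_apply, hφ1, smul_eq_mul] at this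
        exact this.symm
    choose t ht0 ht1 using hd'
    simp only [det4, ht0, ht1]
    ring
  · intro c ρ _
    by_contra hC
    obtain ⟨q, hq, hqT, hqC⟩ := ext _ hC
    apply key q hq hqT
    have hs : ∀ k, (((q k).1 : ℝ) ^ 2 + ((q k).2 : ℝ) ^ 2) - (((q 0).1 : ℝ) ^ 2 + ((q 0).2 : ℝ) ^ 2)
        = 2 * c 0 * (((q k).1 : ℝ) - (q 0).1) + 2 * c 1 * (((q k).2 : ℝ) - (q 0).2) := by
      have h : ∀ k, (((q k).1 : ℝ) - c 0) ^ 2 + (((q k).2 : ℝ) - c 1) ^ 2 = ρ ^ 2 := by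
        intro k
        have := mem_sphere_iff_norm.1 (hqC k)
        have h2 := EuclideanSpace.norm_sq_eq (φ (q k) - c)
        rw [this] at h2
        simp only [Fin.sum_univ_two, PiLp.sub_apply, hφ0, hφ1, Real.norm_eq_abs, sq_abs] at h2
        exact h2.symm
      intro k
      linear_combination h k - h 0
    simp only [det4, hs]
    ring

theorem no_four_on_a_circle :
    ∃ N : ℕ, ∀ n ≥ N, ∃ S : Set (EuclideanSpace ℝ (Fin 2)),
      S ⊆ grid n ∧ 7 * (n : ℝ) / 12 ≤ S.ncard ∧
      (∀ L : AffineSubspace ℝ (EuclideanSpace ℝ (Fin 2)),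
        Module.finrank ℝ L.direction = 1 →
          (S ∩ (L : Set (EuclideanSpace ℝ (Fin 2)))).ncard ≤ 3) ∧
      (∀ (c : EuclideanSpace ℝ (Fin 2)) (ρ : ℝ), 0 < ρ →
          (S ∩ Metric.sphere c ρ).ncard ≤ 3) := by
  obtain ⟨N, hN⟩ := exists_prime4
  refine ⟨N, fun n hn => ?_⟩
  obtain ⟨p, hp, hp4, h1, h2⟩ := hN n hn
  obtain ⟨S, hS, hc, hL, hC⟩ := construct n p hp hp4
  refine ⟨S, hS, ?_, hL, hC⟩
  have hp0 : (0 : ℝ) < p := by exact_mod_cast hp.pos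
  have h1' : 7 * (n : ℝ) ≤ 12 * p := by exact_mod_cast h1
  have h2' : 7 * (p : ℝ) ≤ 12 * n := by exact_mod_cast h2
  have hn0 : (0 : ℝ) ≤ n := by positivity
  have : (p : ℝ) * (7 * n / 12) ≤ p * S.ncard := by
    refine le_trans ?_ hc
    rcases le_total n p with h | h
    · rw [min_eq_left h]; nlinarith
    · rw [min_eq_right h]; nlinarith
  exact le_of_mul_le_mul_left this hp0
end

section
/- Let r > 3 be an integer, and let A(n,2,1,r) denote the number of ordered r-tuples of points of [n]^2 all of whose entries lie on a common line in ℝ^2. Then there exist a constant C > 0 and N ∈ ℕ such that for all n ≥ N, |A(n,2,1,r) − (2(r+3)/(r+1)) · (ζ(r−2)/ζ(r−1)) · n^{r+1}| ≤ C · n^r · log n, where ζ denotes the Riemann zeta function. -/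
/-- `A(n,2,1,r)`: the number of ordered `r`-tuples of points of `[n]^2` all of whose entries
lie on a common line (one-dimensional affine subspace) of `ℝ^2`. -/
noncomputable def collinearCount (n r : ℕ) : ℕ :=
  {t : Fin r → EuclideanSpace ℝ (Fin 2) | (∀ i, t i ∈ grid n) ∧
    ∃ L : AffineSubspace ℝ (EuclideanSpace ℝ (Fin 2)),
      Module.finrank ℝ L.direction = 1 ∧ ∀ i, t i ∈ L}.ncard

/-- the integer box -/
noncomputable def boxF (n : ℕ) : Finset (ℤ × ℤ) := Finset.Icc 1 (n : ℤ) ×ˢ Finset.Icc 1 (n : ℤ)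

/-- normalised primitive directions -/
noncomputable def dirsF (n : ℕ) : Finset (ℤ × ℤ) :=
  (Finset.Icc (-(n : ℤ)) n ×ˢ Finset.Icc (-(n : ℤ)) n).filter
    (fun d => Int.gcd d.1 d.2 = 1 ∧ (0 < d.1 + d.2 ∨ (d.1 + d.2 = 0 ∧ 0 < d.1)))

/-- profiles with minimum `0` and maximum `k` -/
noncomputable def profF (r k : ℕ) : Finset (Fin r → ℤ) :=
  (Fintype.piFinset fun _ => Finset.Icc 0 (k : ℤ)).filter
    (fun f => (∃ i, f i = 0) ∧ ∃ i, f i = k)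

/-- base points -/
noncomputable def baseF (n : ℕ) (d : ℤ × ℤ) (k : ℕ) : Finset (ℤ × ℤ) :=
  (Finset.Icc 1 (n : ℤ)).filter (fun x => x + k * d.1 ∈ Finset.Icc 1 (n : ℤ)) ×ˢ
  (Finset.Icc 1 (n : ℤ)).filter (fun x => x + k * d.2 ∈ Finset.Icc 1 (n : ℤ))

/-- index set -/
noncomputable def indF (n r : ℕ) : Finset ((_ : (ℤ × ℤ) × ℕ) × ((Fin r → ℤ) × (ℤ × ℤ))) :=
  (dirsF n ×ˢ Finset.Icc 1 n).sigma (fun x => profF r x.2 ×ˢ baseF n x.1 x.2)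

/-- the tuple attached to an index -/
noncomputable def tupF (r : ℕ) (x : (_ : (ℤ × ℤ) × ℕ) × ((Fin r → ℤ) × (ℤ × ℤ))) : Fin r → ℤ × ℤ :=
  fun i => (x.2.2.1 + x.2.1 i * x.1.1.1, x.2.2.2 + x.2.1 i * x.1.1.2)

lemma card_filter_shift (n k : ℕ) (a : ℤ) :
    ((Finset.Icc 1 (n : ℤ)).filter (fun x => x + k * a ∈ Finset.Icc 1 (n : ℤ))).card
      = n - k * a.natAbs := by
  have h : (Finset.Icc 1 (n : ℤ)).filter (fun x => x + k * a ∈ Finset.Icc 1 (n : ℤ))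
      = Finset.Icc (max 1 (1 - k * a)) (min (n : ℤ) (n - k * a)) := by
    ext x; simp only [Finset.mem_filter, Finset.mem_Icc]; omega
  rw [h, Int.card_Icc]
  have h2 : k * a.natAbs = (k * a : ℤ).natAbs := by rw [Int.natAbs_mul]; simp
  rw [h2]
  omega

lemma card_baseF (n k : ℕ) (d : ℤ × ℤ) :
    (baseF n d k).card = (n - k * d.1.natAbs) * (n - k * d.2.natAbs) := by
  rw [baseF, Finset.card_product, card_filter_shift, card_filter_shift]

lemma card_indF (n r : ℕ) : (indF n r).card =
    ∑ d ∈ dirsF n, ∑ k ∈ Finset.Icc 1 n,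
      (profF r k).card * ((n - k * d.1.natAbs) * (n - k * d.2.natAbs)) := by
  rw [indF, Finset.card_sigma, Finset.sum_product]
  simp only [Finset.card_product, card_baseF]

lemma dir_unique {a b a' b' : ℤ} (h : Int.gcd a b = 1) (h' : Int.gcd a' b' = 1)
    (hn : 0 < a + b ∨ (a + b = 0 ∧ 0 < a)) (hn' : 0 < a' + b' ∨ (a' + b' = 0 ∧ 0 < a'))
    (hc : a * b' = a' * b) : a = a' ∧ b = b' := by
  have h1 : a ∣ a' := (Int.isCoprime_iff_gcd_eq_one.mpr h).dvd_of_dvd_mul_right ⟨b', by linarith⟩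
  have h2 : a' ∣ a := (Int.isCoprime_iff_gcd_eq_one.mpr h').dvd_of_dvd_mul_right ⟨b, by linarith⟩
  have h3 : b ∣ b' := (Int.isCoprime_iff_gcd_eq_one.mpr h).symm.dvd_of_dvd_mul_left ⟨a', by linarith⟩
  have h4 : b' ∣ b := (Int.isCoprime_iff_gcd_eq_one.mpr h').symm.dvd_of_dvd_mul_left ⟨a, by linarith⟩
  have h5 := Int.natAbs_eq_of_dvd_dvd h1 h2
  have h6 := Int.natAbs_eq_of_dvd_dvd h3 h4
  rcases Int.natAbs_eq_natAbs_iff.mp h5 with e | e <;>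
  rcases Int.natAbs_eq_natAbs_iff.mp h6 with f | f
  · exact ⟨e, f⟩
  · subst e; subst f
    have : a * b' = 0 := by linarith
    rcases mul_eq_zero.mp this with e | e <;> subst e <;> simp at * <;> omega
  · subst e; subst f
    have : a' * b = 0 := by linarith
    rcases mul_eq_zero.mp this with e | e <;> subst e <;> simp at * <;> omega
  · omega

lemma mem_dirsF {n : ℕ} {d : ℤ × ℤ} : d ∈ dirsF n ↔
    ((-(n:ℤ) ≤ d.1 ∧ d.1 ≤ n) ∧ (-(n:ℤ) ≤ d.2 ∧ d.2 ≤ n)) ∧ Int.gcd d.1 d.2 = 1 ∧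
      (0 < d.1 + d.2 ∨ (d.1 + d.2 = 0 ∧ 0 < d.1)) := by
  simp [dirsF]

lemma mem_profF {r k : ℕ} {f : Fin r → ℤ} : f ∈ profF r k ↔
    (∀ i, 0 ≤ f i ∧ f i ≤ k) ∧ (∃ i, f i = 0) ∧ ∃ i, f i = k := by
  simp [profF]

lemma tupF_injOn (n r : ℕ) : Set.InjOn (tupF r) (indF n r : Set _) := by
  rintro ⟨⟨⟨a, b⟩, k⟩, ⟨f, ⟨p, q⟩⟩⟩ hx ⟨⟨⟨a', b'⟩, k'⟩, ⟨f', ⟨p', q'⟩⟩⟩ hx' he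
  simp only [indF, Finset.coe_sigma, Set.mem_sigma_iff, Finset.mem_coe, Finset.mem_product,
    mem_dirsF, mem_profF, Finset.mem_Icc] at hx hx'
  obtain ⟨⟨⟨_, hg, hn⟩, hk, -⟩, ⟨hf, ⟨i0, hi0⟩, ⟨i1, hi1⟩⟩, -⟩ := hx
  obtain ⟨⟨⟨_, hg', hn'⟩, hk', -⟩, ⟨hf', ⟨j0, hj0⟩, ⟨j1, hj1⟩⟩, -⟩ := hx'
  have e1 : ∀ i, p + f i * a = p' + f' i * a' := fun i => congrArg Prod.fst (congrFun he i)
  have e2 : ∀ i, q + f i * b = q' + f' i * b' := fun i => congrArg Prod.snd (congrFun he i)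
  have hc : a * b' = a' * b := by
    have x1 := e1 i0; have x2 := e1 i1; have y1 := e2 i0; have y2 := e2 i1
    rw [hi0] at x1 y1; rw [hi1] at x2 y2
    have u1 : (k : ℤ) * a = (f' i1 - f' i0) * a' := by linarith
    have u2 : (k : ℤ) * b = (f' i1 - f' i0) * b' := by linarith
    have : (k : ℤ) * (a * b') = k * (a' * b) := by
      calc (k : ℤ) * (a * b') = (k * a) * b' := by ring
        _ = a' * ((f' i1 - f' i0) * b') := by rw [u1]; ring
        _ = _ := by rw [← u2]; ring
    exact mul_left_cancel₀ (by positivity) this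
  obtain ⟨rfl, rfl⟩ := dir_unique hg hg' hn hn' hc
  have hd : ∀ i, f i - f' i = f i0 - f' i0 := by
    intro i
    have x1 := e1 i; have x2 := e1 i0; have y1 := e2 i; have y2 := e2 i0
    have z1 : ((f i - f' i) - (f i0 - f' i0)) * a = 0 := by linarith
    have z2 : ((f i - f' i) - (f i0 - f' i0)) * b = 0 := by linarith
    rcases mul_eq_zero.mp z1 with z | z
    · linarith
    rcases mul_eq_zero.mp z2 with w | w
    · linarith
    simp [z, w] at hg
  have hff : f = f' := by
    funext i
    have := hd i; have := hd j0; have := hf' i0; have := hf j0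
    omega
  subst hff
  have hp : p = p' := by linarith [e1 i0]
  have hq : q = q' := by linarith [e2 i0]
  have hkk : k = k' := by
    have := hf i1; have := hf j1; have := hf' i1; have := hf' j1
    omega
  subst hp hq hkk
  rfl

lemma exists_primitive {a b : ℤ} (h : ¬ (a = 0 ∧ b = 0)) : ∃ a' b' : ℤ, Int.gcd a' b' = 1 ∧
    (0 < a' + b' ∨ (a' + b' = 0 ∧ 0 < a')) ∧ a * b' = b * a' := by
  have hg : 0 < Int.gcd a b := by
    rw [Int.gcd_pos_iff]; tauto
  obtain ⟨a1, b1, hc, ha, hb⟩ := Int.exists_gcd_one hg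
  by_cases hs : 0 < a1 + b1 ∨ (a1 + b1 = 0 ∧ 0 < a1)
  · refine ⟨a1, b1, hc, hs, ?_⟩
    generalize (Int.gcd a b : ℤ) = g at *
    rw [ha, hb]; ring
  · refine ⟨-a1, -b1, by simpa using hc, ?_, ?_⟩
    · by_contra h2
      have h3 : a1 = 0 := by omega
      have h4 : b1 = 0 := by omega
      rw [h3, h4] at hc
      simp at hc
    · generalize (Int.gcd a b : ℤ) = g at *
      rw [ha, hb]; ring

lemma mem_image_tupF (n r : ℕ) (t : Fin r → ℤ × ℤ) (ht : ∀ i, t i ∈ boxF n)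
    (hc : ∀ i j k, ((t j).1 - (t i).1) * ((t k).2 - (t i).2)
      = ((t k).1 - (t i).1) * ((t j).2 - (t i).2))
    (i0 i1 : Fin r) (hne : t i0 ≠ t i1) : t ∈ (indF n r).image (tupF r) := by
  have hne' : ¬ ((t i1).1 - (t i0).1 = 0 ∧ (t i1).2 - (t i0).2 = 0) := by
    rintro ⟨h1, h2⟩; apply hne; ext <;> linarith
  obtain ⟨a, b, hg, hn, hab⟩ := exists_primitive hne'
  have hcop := Int.isCoprime_iff_gcd_eq_one.mpr hg
  obtain ⟨u, v, huv⟩ := hcop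
  have hm : ∀ i, ∃ m : ℤ, (t i).1 = (t i0).1 + m * a ∧ (t i).2 = (t i0).2 + m * b := by
    intro i
    have h1 := hc i0 i1 i
    have h2 : ((t i).1 - (t i0).1) * b = ((t i).2 - (t i0).2) * a := by
      generalize (t i).1 - (t i0).1 = X at *
      generalize (t i).2 - (t i0).2 = Y at *
      generalize (t i1).1 - (t i0).1 = W at *
      generalize (t i1).2 - (t i0).2 = Z at *
      by_cases hW : W = 0
      · have hZ : Z ≠ 0 := fun h => hne' ⟨hW, h⟩
        apply mul_left_cancel₀ hZ
        linear_combination Y * hab - b * h1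
      · apply mul_left_cancel₀ hW
        linear_combination X * hab - a * h1
    refine ⟨u * ((t i).1 - (t i0).1) + v * ((t i).2 - (t i0).2), ?_, ?_⟩
    · linear_combination v * h2 - ((t i).1 - (t i0).1) * huv
    · linear_combination (-u) * h2 - ((t i).2 - (t i0).2) * huv
  choose m hm1 hm2 using hm
  have : Nonempty (Fin r) := ⟨i0⟩
  obtain ⟨l, hl⟩ := Finite.exists_min m
  obtain ⟨w, hw⟩ := Finite.exists_max m
  have hlw : m l < m w := by
    rcases (hl w).lt_or_eq with h | h
    · exact h
    · exfalso; apply hne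
      have h3 : m i0 = m i1 := by
        have := hl i0; have := hl i1; have := hw i0; have := hw i1; omega
      ext
      · rw [hm1 i0, hm1 i1, h3]
      · rw [hm2 i0, hm2 i1, h3]
  obtain ⟨k, hk⟩ := Int.eq_ofNat_of_zero_le (sub_nonneg.mpr hlw.le)
  have hkpos : 1 ≤ k := by omega
  have bl := ht l
  have bw := ht w
  simp only [boxF, Finset.mem_product, Finset.mem_Icc] at bl bw
  have ew1 : (t w).1 = (t l).1 + k * a := by
    rw [hm1 w, hm1 l, ← hk]; ring
  have ew2 : (t w).2 = (t l).2 + k * b := by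
    rw [hm2 w, hm2 l, ← hk]; ring
  have hka : |(k : ℤ) * a| ≤ n := by rw [abs_le]; constructor <;> linarith
  have hkb : |(k : ℤ) * b| ≤ n := by rw [abs_le]; constructor <;> linarith
  have hk1 : (1 : ℤ) ≤ k := by exact_mod_cast hkpos
  have hbound : ∀ x : ℤ, |(k : ℤ) * x| ≤ n → |x| ≤ n := by
    intro x hx
    rw [abs_mul, abs_of_nonneg (by positivity)] at hx
    nlinarith [abs_nonneg x]
  have hkn : k ≤ n := by
    have : (1 : ℤ) ≤ |a| ∨ (1 : ℤ) ≤ |b| := by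
      by_contra! h
      have h3 : a = 0 := by rw [← abs_eq_zero]; have := abs_nonneg a; omega
      have h4 : b = 0 := by rw [← abs_eq_zero]; have := abs_nonneg b; omega
      rw [h3, h4] at hg
      simp at hg
    rw [abs_mul, abs_of_nonneg (by positivity : (0 : ℤ) ≤ k)] at hka hkb
    have : (k : ℤ) ≤ n := by
      rcases this with h | h
      · nlinarith
      · nlinarith
    exact_mod_cast this
  rw [Finset.mem_image]
  refine ⟨⟨((a, b), k), (fun i => m i - m l, t l)⟩, ?_, ?_⟩
  · simp only [indF, Finset.mem_sigma, Finset.mem_product, mem_dirsF, mem_profF, Finset.mem_Icc,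
      baseF, Finset.mem_filter]
    refine ⟨⟨⟨⟨abs_le.mp (hbound a hka), abs_le.mp (hbound b hkb)⟩, hg, hn⟩, hkpos, hkn⟩,
      ⟨fun i => ⟨sub_nonneg.mpr (hl i), ?_⟩, ⟨l, sub_self _⟩, ⟨w, hk⟩⟩,
      ⟨bl.1, ?_⟩, ⟨bl.2, ?_⟩⟩
    · have := hw i; have : m w - m l = k := hk; omega
    · rw [← ew1]; exact bw.1
    · rw [← ew2]; exact bw.2
  · funext i
    simp only [tupF]
    ext
    · simp only; rw [hm1 l, hm1 i]; ring
    · simp only; rw [hm2 l, hm2 i]; ring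

lemma tupF_mem (n r : ℕ) {x} (hx : x ∈ indF n r) (i : Fin r) : tupF r x i ∈ boxF n := by
  obtain ⟨⟨⟨a, b⟩, k⟩, ⟨f, ⟨p, q⟩⟩⟩ := x
  simp only [indF, Finset.mem_sigma, Finset.mem_product, mem_dirsF, mem_profF, Finset.mem_Icc,
      baseF, Finset.mem_filter] at hx
  obtain ⟨-, ⟨hf, -⟩, ⟨h1, h2⟩, ⟨h3, h4⟩⟩ := hx
  have key : ∀ x y : ℤ, (1 ≤ x ∧ x ≤ n) → (1 ≤ x + k * y ∧ x + k * y ≤ n) →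
      1 ≤ x + f i * y ∧ x + f i * y ≤ n := by
    intro x y hx hy
    have := hf i
    rcases le_total 0 y with h | h
    · constructor <;> nlinarith
    · constructor <;> nlinarith
  simp only [boxF, tupF, Finset.mem_product, Finset.mem_Icc]
  exact ⟨key _ _ h1 h2, key _ _ h3 h4⟩

/-- embedding of integer tuples -/
noncomputable def embF (r : ℕ) (t : Fin r → ℤ × ℤ) : Fin r → EuclideanSpace ℝ (Fin 2) :=
  fun i => !₂[((t i).1 : ℝ), ((t i).2 : ℝ)]

lemma embF_inj (r : ℕ) : Function.Injective (embF r) := by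
  intro s t h
  funext i
  have h1 := congrFun h i
  have h2 := congrArg (fun x : EuclideanSpace ℝ (Fin 2) => x 0) h1
  have h3 := congrArg (fun x : EuclideanSpace ℝ (Fin 2) => x 1) h1
  simp [embF] at h2 h3
  ext
  · exact h2
  · exact h3

lemma embF_mem_grid {n r : ℕ} {t : Fin r → ℤ × ℤ} {i : Fin r} (h : t i ∈ boxF n) :
    embF r t i ∈ grid n := by
  simp only [boxF, Finset.mem_product, Finset.mem_Icc] at h
  obtain ⟨⟨h1, h2⟩, h3, h4⟩ := h
  intro j
  fin_cases j
  · refine ⟨(t i).1.toNat, by omega, by omega, ?_⟩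
    have : (((t i).1.toNat : ℤ) : ℝ) = ((t i).1 : ℝ) := by rw [Int.toNat_of_nonneg (by omega)]
    rw [Int.cast_natCast] at this
    rw [this]
    simp [embF]
  · refine ⟨(t i).2.toNat, by omega, by omega, ?_⟩
    have : (((t i).2.toNat : ℤ) : ℝ) = ((t i).2 : ℝ) := by rw [Int.toNat_of_nonneg (by omega)]
    rw [Int.cast_natCast] at this
    rw [this]
    simp [embF]

lemma exists_line (p v : EuclideanSpace ℝ (Fin 2)) (hv : v ≠ 0) :
    ∃ L : AffineSubspace ℝ (EuclideanSpace ℝ (Fin 2)),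
      Module.finrank ℝ L.direction = 1 ∧ ∀ c : ℝ, p + c • v ∈ L := by
  refine ⟨AffineSubspace.mk' p (Submodule.span ℝ {v}), ?_, ?_⟩
  · rw [AffineSubspace.direction_mk', finrank_span_singleton hv]
  · intro c
    rw [AffineSubspace.mem_mk']
    simp [Submodule.mem_span_singleton]

lemma collinear_set_eq (n r : ℕ) (hr : 0 < r) :
    {t : Fin r → EuclideanSpace ℝ (Fin 2) | (∀ i, t i ∈ grid n) ∧
    ∃ L : AffineSubspace ℝ (EuclideanSpace ℝ (Fin 2)),
      Module.finrank ℝ L.direction = 1 ∧ ∀ i, t i ∈ L} =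
    embF r '' (((boxF n).image (fun p => (fun _ => p : Fin r → ℤ × ℤ)) ∪
      (indF n r).image (tupF r) : Finset _) : Set (Fin r → ℤ × ℤ)) := by
  ext t
  constructor
  · rintro ⟨hg, L, hL, hmem⟩
    choose m hm1 hm2 hm3 using hg
    set s : Fin r → ℤ × ℤ := fun i => ((m i 0 : ℤ), (m i 1 : ℤ)) with hs
    have hst : embF r s = t := by
      funext i
      ext j
      fin_cases j
      · simp [embF, hs, hm3]
      · simp [embF, hs, hm3]
    have hbox : ∀ i, s i ∈ boxF n := by
      intro i
      simp only [boxF, Finset.mem_product, Finset.mem_Icc, hs]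
      have := hm1 i 0; have := hm2 i 0; have := hm1 i 1; have := hm2 i 1
      omega
    refine ⟨s, ?_, hst⟩
    rw [Finset.mem_coe, Finset.mem_union]
    by_cases hconst : ∃ i j, s i ≠ s j
    · right
      obtain ⟨i0, i1, hne⟩ := hconst
      refine mem_image_tupF n r s hbox ?_ i0 i1 hne
      obtain ⟨v, -, hv⟩ := finrank_eq_one_iff'.mp hL
      have hd : ∀ i j, ∃ c : ℝ, (((s j).1 : ℝ) - (s i).1) = c * (v : EuclideanSpace ℝ (Fin 2)) 0 ∧
          (((s j).2 : ℝ) - (s i).2) = c * (v : EuclideanSpace ℝ (Fin 2)) 1 := by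
        intro i j
        have h1 : t j -ᵥ t i ∈ L.direction := AffineSubspace.vsub_mem_direction (hmem j) (hmem i)
        obtain ⟨c, hc⟩ := hv ⟨_, h1⟩
        have h2 := congrArg Subtype.val hc
        have h3 := congrArg (fun x : EuclideanSpace ℝ (Fin 2) => x 0) h2
        have h4 := congrArg (fun x : EuclideanSpace ℝ (Fin 2) => x 1) h2
        refine ⟨c, ?_, ?_⟩
        · simp [hm3] at h3
          simp [hs, h3]
        · simp [hm3] at h4
          simp [hs, h4]
      intro i j k
      obtain ⟨c, hc1, hc2⟩ := hd i j
      obtain ⟨e, he1, he2⟩ := hd i k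
      have : (((s j).1 : ℝ) - (s i).1) * ((s k).2 - (s i).2)
        = ((s k).1 - (s i).1) * ((s j).2 - (s i).2) := by
        rw [hc1, hc2, he1, he2]; ring
      exact_mod_cast this
    · left
      push Not at hconst
      rw [Finset.mem_image]
      exact ⟨s ⟨0, hr⟩, hbox _, funext fun i => hconst _ _⟩
  · rintro ⟨s, hs, rfl⟩
    rw [Finset.mem_coe, Finset.mem_union, Finset.mem_image, Finset.mem_image] at hs
    rcases hs with ⟨p, hp, rfl⟩ | ⟨x, hx, rfl⟩
    · refine ⟨fun i => embF_mem_grid hp, ?_⟩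
      obtain ⟨L, hL, hL2⟩ := exists_line (!₂[(p.1 : ℝ), (p.2 : ℝ)]) (!₂[(1 : ℝ), 0])
        (fun h => by simpa using congrArg (fun x : EuclideanSpace ℝ (Fin 2) => x 0) h)
      refine ⟨L, hL, fun i => ?_⟩
      have := hL2 0
      rw [zero_smul, add_zero] at this
      exact this
    · refine ⟨fun i => embF_mem_grid (tupF_mem n r hx i), ?_⟩
      obtain ⟨⟨⟨a, b⟩, k⟩, ⟨f, ⟨p, q⟩⟩⟩ := x
      have hg : Int.gcd a b = 1 := by
        simp only [indF, Finset.mem_sigma, Finset.mem_product, mem_dirsF] at hx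
        exact hx.1.1.2.1
      obtain ⟨L, hL, hL2⟩ := exists_line (!₂[(p : ℝ), (q : ℝ)]) (!₂[(a : ℝ), (b : ℝ)])
        (fun h => by
          have h1 := congrArg (fun x : EuclideanSpace ℝ (Fin 2) => x 0) h
          have h2 := congrArg (fun x : EuclideanSpace ℝ (Fin 2) => x 1) h
          simp at h1 h2
          rw [h1, h2] at hg
          simp at hg)
      refine ⟨L, hL, fun i => ?_⟩
      convert hL2 (f i) using 1
      ext j
      fin_cases j <;> simp [embF, tupF]

lemma collinearCount_eq (n r : ℕ) (hr : 0 < r) : collinearCount n r = n ^ 2 +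
    ∑ d ∈ dirsF n, ∑ k ∈ Finset.Icc 1 n,
      (profF r k).card * ((n - k * d.1.natAbs) * (n - k * d.2.natAbs)) := by
  rw [collinearCount, collinear_set_eq n r hr, Set.ncard_image_of_injective _ (embF_inj r),
    Set.ncard_coe_finset, Finset.card_union_of_disjoint, Finset.card_image_of_injOn (tupF_injOn n r),
    card_indF, Finset.card_image_of_injective]
  · simp [boxF, sq]
  · intro p q h
    exact congrFun h ⟨0, hr⟩
  · rw [Finset.disjoint_left]
    intro t h1 h2
    rw [Finset.mem_image] at h1 h2
    obtain ⟨p, -, rfl⟩ := h1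
    obtain ⟨⟨⟨⟨a, b⟩, k⟩, ⟨f, ⟨p', q'⟩⟩⟩, hx, he⟩ := h2
    simp only [indF, Finset.mem_sigma, Finset.mem_product, mem_dirsF, mem_profF,
      Finset.mem_Icc] at hx
    obtain ⟨⟨⟨_, hg, hn⟩, hk, -⟩, ⟨hf, ⟨i0, hi0⟩, ⟨i1, hi1⟩⟩, -⟩ := hx
    have h3 := (congrFun he i0).trans (congrFun he i1).symm
    simp only [tupF, hi0, hi1, Prod.mk.injEq] at h3
    have ha : (k : ℤ) * a = 0 := by linarith [h3.1]
    have hb : (k : ℤ) * b = 0 := by linarith [h3.2]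
    have hk0 : (k : ℤ) ≠ 0 := by positivity
    have ha' : a = 0 := (mul_eq_zero.mp ha).resolve_left hk0
    have hb' : b = 0 := (mul_eq_zero.mp hb).resolve_left hk0
    rw [ha', hb'] at hg
    simp at hg

lemma card_profF (r k : ℕ) (hk : 1 ≤ k) :
    ((profF r k).card : ℝ) = ((k : ℝ) + 1) ^ r - 2 * (k : ℝ) ^ r + ((k : ℝ) - 1) ^ r := by
  set U : Finset (Fin r → ℤ) := Fintype.piFinset fun _ => Finset.Icc 0 (k : ℤ) with hU
  set V : Finset (Fin r → ℤ) := Fintype.piFinset fun _ => Finset.Icc 1 (k : ℤ) with hV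
  set W : Finset (Fin r → ℤ) := Fintype.piFinset fun _ => Finset.Icc 0 ((k : ℤ) - 1) with hW
  have h1 : profF r k = U \ (V ∪ W) := by
    ext f
    simp only [mem_profF, hU, hV, hW, Finset.mem_sdiff, Finset.mem_union, Fintype.mem_piFinset,
      Finset.mem_Icc, not_or, not_forall]
    refine and_congr_right fun h => and_congr (exists_congr fun i => ?_) (exists_congr fun i => ?_)
    · have := h i; omega
    · have := h i; omega
  have h2 : V ∩ W = Fintype.piFinset fun _ => Finset.Icc 1 ((k : ℤ) - 1) := by
    ext f
    simp only [hV, hW, Finset.mem_inter, Fintype.mem_piFinset, Finset.mem_Icc, ← forall_and]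
    refine forall_congr' fun i => ?_
    omega
  have hsub : V ∪ W ⊆ U := by
    intro f
    simp only [hU, hV, hW, Finset.mem_union, Fintype.mem_piFinset, Finset.mem_Icc]
    rintro (h | h) i
    · have := h i; omega
    · have := h i; omega
  have c1 := Finset.card_sdiff_add_card_eq_card hsub
  have c2 := Finset.card_union_add_card_inter V W
  rw [← h1] at c1
  have cU : (U.card : ℝ) = ((k : ℝ) + 1) ^ r := by
    rw [hU, Fintype.card_piFinset]; simp
  have cV : (V.card : ℝ) = (k : ℝ) ^ r := by
    rw [hV, Fintype.card_piFinset]; simp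
  have cW : (W.card : ℝ) = (k : ℝ) ^ r := by
    rw [hW, Fintype.card_piFinset]; simp
  have cVW : ((V ∩ W).card : ℝ) = ((k : ℝ) - 1) ^ r := by
    rw [h2, Fintype.card_piFinset]; simp
    obtain ⟨j, rfl⟩ := Nat.exists_eq_add_of_le hk
    push_cast
    simp
  have c1' : ((profF r k).card : ℝ) + ((V ∪ W).card : ℝ) = U.card := by exact_mod_cast c1
  have c2' : ((V ∪ W).card : ℝ) + ((V ∩ W).card : ℝ) = V.card + W.card := by exact_mod_cast c2
  rw [cU] at c1'
  rw [cV, cW, cVW] at c2'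
  linarith

lemma sum_dirsF (n : ℕ) (F : ℕ → ℕ → ℕ) (hF : ∀ a b, F a b = F b a) :
    ∑ d ∈ dirsF n, F d.1.natAbs d.2.natAbs =
      2 * ∑ m ∈ Finset.Icc 1 n, ∑ b ∈ (Finset.range m).filter m.Coprime,
        (F m b + F m (m - b)) := by
  have hsplit : ∑ d ∈ dirsF n, F d.1.natAbs d.2.natAbs =
      ∑ d ∈ (dirsF n).filter (fun d => 0 ≤ d.2 ∧ d.2 < d.1), F d.1.natAbs d.2.natAbs +
      ∑ d ∈ (dirsF n).filter (fun d => d.1 ≤ 0 ∧ -d.1 < d.2), F d.1.natAbs d.2.natAbs +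
      ∑ d ∈ (dirsF n).filter (fun d => 0 < d.1 ∧ d.1 ≤ d.2), F d.1.natAbs d.2.natAbs +
      ∑ d ∈ (dirsF n).filter (fun d => d.2 < 0 ∧ -d.2 ≤ d.1), F d.1.natAbs d.2.natAbs := by
    simp only [Finset.sum_filter, ← Finset.sum_add_distrib]
    refine Finset.sum_congr rfl fun d hd => ?_
    rw [mem_dirsF] at hd
    split_ifs <;> omega
  have s1 : ∑ d ∈ (dirsF n).filter (fun d => 0 ≤ d.2 ∧ d.2 < d.1), F d.1.natAbs d.2.natAbs =
      ∑ x ∈ (Finset.Icc 1 n).sigma (fun m => (Finset.range m).filter m.Coprime), F x.1 x.2 := by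
    refine Finset.sum_nbij' (fun d => ⟨d.1.natAbs, d.2.natAbs⟩)
      (fun x => ((x.1 : ℤ), (x.2 : ℤ))) ?_ ?_ ?_ ?_ ?_
    · rintro ⟨a, b⟩ h
      simp only [Finset.mem_filter, mem_dirsF, Finset.mem_sigma, Finset.mem_Icc,
        Finset.mem_range, Int.gcd_def, Nat.Coprime] at h ⊢
      refine ⟨?_, ?_, h.1.2.1⟩ <;> omega
    · rintro ⟨a, b⟩ h
      simp only [Finset.mem_filter, mem_dirsF, Finset.mem_sigma, Finset.mem_Icc,
        Finset.mem_range, Int.gcd_def, Nat.Coprime, Int.natAbs_natCast] at h ⊢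
      refine ⟨⟨?_, h.2.2, ?_⟩, ?_⟩ <;> omega
    · rintro ⟨a, b⟩ h
      simp only [Finset.mem_filter] at h
      refine Prod.ext ?_ ?_ <;> dsimp only <;> omega
    · rintro ⟨a, b⟩ h
      simp
    · intros; rfl
  have s2 : ∑ d ∈ (dirsF n).filter (fun d => d.1 ≤ 0 ∧ -d.1 < d.2), F d.1.natAbs d.2.natAbs =
      ∑ x ∈ (Finset.Icc 1 n).sigma (fun m => (Finset.range m).filter m.Coprime), F x.1 x.2 := by
    refine Finset.sum_nbij' (fun d => ⟨d.2.natAbs, d.1.natAbs⟩)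
      (fun x => (-(x.2 : ℤ), (x.1 : ℤ))) ?_ ?_ ?_ ?_ ?_
    · rintro ⟨a, b⟩ h
      simp only [Finset.mem_filter, mem_dirsF, Finset.mem_sigma, Finset.mem_Icc,
        Finset.mem_range, Int.gcd_def, Nat.Coprime] at h ⊢
      refine ⟨?_, ?_, (Nat.gcd_comm _ _).trans h.1.2.1⟩ <;> omega
    · rintro ⟨a, b⟩ h
      simp only [Finset.mem_filter, mem_dirsF, Finset.mem_sigma, Finset.mem_Icc,
        Finset.mem_range, Int.gcd_def, Nat.Coprime, Int.natAbs_natCast, Int.natAbs_neg] at h ⊢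
      refine ⟨⟨?_, (Nat.gcd_comm _ _).trans h.2.2, ?_⟩, ?_⟩ <;> omega
    · rintro ⟨a, b⟩ h
      simp only [Finset.mem_filter] at h
      refine Prod.ext ?_ ?_ <;> dsimp only <;> omega
    · rintro ⟨a, b⟩ h
      simp
    · intros; exact hF _ _
  have hcop : ∀ m b : ℕ, b ≤ m → (m.gcd (m - b) = 1 ↔ m.gcd b = 1) := by
    intro m b h
    exact Nat.coprime_self_sub_right h
  have s3 : ∑ d ∈ (dirsF n).filter (fun d => 0 < d.1 ∧ d.1 ≤ d.2), F d.1.natAbs d.2.natAbs =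
      ∑ x ∈ (Finset.Icc 1 n).sigma (fun m => (Finset.range m).filter m.Coprime),
        F x.1 (x.1 - x.2) := by
    refine Finset.sum_nbij' (fun d => ⟨d.2.natAbs, d.2.natAbs - d.1.natAbs⟩)
      (fun x => (((x.1 - x.2 : ℕ) : ℤ), (x.1 : ℤ))) ?_ ?_ ?_ ?_ ?_
    · rintro ⟨a, b⟩ h
      simp only [Finset.mem_filter, mem_dirsF, Finset.mem_sigma, Finset.mem_Icc,
        Finset.mem_range, Int.gcd_def, Nat.Coprime] at h ⊢
      refine ⟨?_, ?_, (hcop _ _ ?_).mpr ((Nat.gcd_comm _ _).trans h.1.2.1)⟩ <;> omega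
    · rintro ⟨a, b⟩ h
      simp only [Finset.mem_filter, mem_dirsF, Finset.mem_sigma, Finset.mem_Icc,
        Finset.mem_range, Int.gcd_def, Nat.Coprime, Int.natAbs_natCast, Int.natAbs_neg] at h ⊢
      refine ⟨⟨?_, (Nat.gcd_comm _ _).trans ((hcop _ _ ?_).mpr h.2.2), ?_⟩, ?_⟩ <;> omega
    · rintro ⟨a, b⟩ h
      simp only [Finset.mem_filter] at h
      refine Prod.ext ?_ ?_ <;> dsimp only <;> omega
    · rintro ⟨a, b⟩ h
      simp only [Finset.mem_filter, Finset.mem_sigma, Finset.mem_Icc, Finset.mem_range] at h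
      simp only [Int.natAbs_natCast, Sigma.mk.injEq, heq_eq_eq, true_and]
      omega
    · rintro ⟨a, b⟩ h
      simp only [Finset.mem_filter] at h
      rw [hF]
      congr 1
      simp only
      omega
  have s4 : ∑ d ∈ (dirsF n).filter (fun d => d.2 < 0 ∧ -d.2 ≤ d.1), F d.1.natAbs d.2.natAbs =
      ∑ x ∈ (Finset.Icc 1 n).sigma (fun m => (Finset.range m).filter m.Coprime),
        F x.1 (x.1 - x.2) := by
    refine Finset.sum_nbij' (fun d => ⟨d.1.natAbs, d.1.natAbs - d.2.natAbs⟩)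
      (fun x => ((x.1 : ℤ), -((x.1 - x.2 : ℕ) : ℤ))) ?_ ?_ ?_ ?_ ?_
    · rintro ⟨a, b⟩ h
      simp only [Finset.mem_filter, mem_dirsF, Finset.mem_sigma, Finset.mem_Icc,
        Finset.mem_range, Int.gcd_def, Nat.Coprime] at h ⊢
      refine ⟨?_, ?_, (hcop _ _ ?_).mpr h.1.2.1⟩ <;> omega
    · rintro ⟨a, b⟩ h
      simp only [Finset.mem_filter, mem_dirsF, Finset.mem_sigma, Finset.mem_Icc,
        Finset.mem_range, Int.gcd_def, Nat.Coprime, Int.natAbs_natCast, Int.natAbs_neg] at h ⊢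
      refine ⟨⟨?_, (hcop _ _ ?_).mpr h.2.2, ?_⟩, ?_⟩ <;> omega
    · rintro ⟨a, b⟩ h
      simp only [Finset.mem_filter] at h
      refine Prod.ext ?_ ?_ <;> dsimp only <;> omega
    · rintro ⟨a, b⟩ h
      simp only [Finset.mem_filter, Finset.mem_sigma, Finset.mem_Icc, Finset.mem_range] at h
      simp only [Int.natAbs_natCast, Int.natAbs_neg, Sigma.mk.injEq, heq_eq_eq, true_and]
      omega
    · rintro ⟨a, b⟩ h
      simp only [Finset.mem_filter] at h
      congr 1
      simp only
      omega
  rw [hsplit, s1, s2, s3, s4, Finset.sum_sigma, Finset.sum_sigma]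
  simp only [Finset.sum_add_distrib]
  ring

lemma uv_bound (r : ℕ) (hr : 3 ≤ r) : ∃ C : ℝ, 0 ≤ C ∧ ∀ x : ℝ, 1 ≤ x →
    |(x + 1) ^ r - 2 * x ^ r + (x - 1) ^ r - r * (r - 1) * x ^ (r - 2)| ≤ C * x ^ (r - 3) ∧
    |(x + 1) ^ r - (x - 1) ^ r - 2 * r * x ^ (r - 1)| ≤ C * x ^ (r - 2) := by
  induction r, hr using Nat.le_induction with
  | base =>
    refine ⟨2, by norm_num, fun x hx => ⟨?_, ?_⟩⟩
    · have : (x + 1) ^ 3 - 2 * x ^ 3 + (x - 1) ^ 3 - ((3 : ℕ) : ℝ) * ((3 : ℕ) - 1) * x ^ (3 - 2) = 0 := by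
        push_cast; norm_num; ring
      rw [this]; simp
    · have : (x + 1) ^ 3 - (x - 1) ^ 3 - 2 * ((3 : ℕ) : ℝ) * x ^ (3 - 1) = 2 := by
        push_cast; norm_num; ring
      rw [this]; norm_num; linarith
  | succ r hr ih =>
    obtain ⟨C, hC, h⟩ := ih
    obtain ⟨s, rfl⟩ := Nat.exists_eq_add_of_le' hr
    refine ⟨2 * C + (s + 3) * (s + 2), by positivity, fun x hx => ?_⟩
    obtain ⟨h1, h2⟩ := h x hx
    have e1 : s + 3 + 1 - 3 = s + 1 := by omega
    have e2 : s + 3 + 1 - 2 = s + 2 := by omega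
    have e3 : s + 3 + 1 - 1 = s + 3 := by omega
    have e4 : s + 3 - 3 = s := by omega
    have e5 : s + 3 - 2 = s + 1 := by omega
    have e6 : s + 3 - 1 = s + 2 := by omega
    rw [e1, e2, e3]
    rw [e4, e5] at h1
    rw [e5, e6] at h2
    push_cast at *
    have hx0 : 0 ≤ x := by linarith
    set u := (x + 1) ^ (s + 3) - 2 * x ^ (s + 3) + (x - 1) ^ (s + 3) with hu
    set v := (x + 1) ^ (s + 3) - (x - 1) ^ (s + 3) with hv
    have hp : (0 : ℝ) ≤ x ^ s := by positivity
    have hp1 : x ^ s ≤ x ^ (s + 1) := pow_le_pow_right₀ hx (by omega)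
    have hp2 : x ^ (s + 1) ≤ x ^ (s + 2) := pow_le_pow_right₀ hx (by omega)
    have hxu : |x * (u - (s + 3) * (s + 3 - 1) * x ^ (s + 1))| ≤ C * x ^ (s + 1) := by
      rw [abs_mul, abs_of_nonneg hx0]
      refine (mul_le_mul_of_nonneg_left h1 hx0).trans (le_of_eq ?_)
      ring
    have hxv : |x * (v - 2 * (s + 3) * x ^ (s + 2))| ≤ C * x ^ (s + 2) := by
      rw [abs_mul, abs_of_nonneg hx0]
      refine (mul_le_mul_of_nonneg_left h2 hx0).trans (le_of_eq ?_)
      ring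
    have i1 : (x + 1) ^ (s + 3 + 1) - 2 * x ^ (s + 3 + 1) + (x - 1) ^ (s + 3 + 1)
        - (s + 3 + 1) * (s + 3 + 1 - 1) * x ^ (s + 2) =
        x * (u - (s + 3) * (s + 3 - 1) * x ^ (s + 1)) + (v - 2 * (s + 3) * x ^ (s + 2)) := by
      rw [hu, hv]; ring
    have i2 : (x + 1) ^ (s + 3 + 1) - (x - 1) ^ (s + 3 + 1) - 2 * (s + 3 + 1) * x ^ (s + 3) =
        x * (v - 2 * (s + 3) * x ^ (s + 2)) + (u - (s + 3) * (s + 3 - 1) * x ^ (s + 1))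
          + (s + 3) * (s + 2) * x ^ (s + 1) := by
      rw [hu, hv]; ring
    have hs : (0 : ℝ) ≤ s := by positivity
    constructor
    · rw [i1]
      refine (abs_add_le _ _).trans ?_
      have : 0 ≤ ((s : ℝ) + 3) * (s + 2) * x ^ (s + 1) := by positivity
      linarith
    · rw [i2]
      refine (abs_add_le _ _).trans ?_
      have h3 := abs_add_le (x * (v - 2 * (s + 3) * x ^ (s + 2))) (u - (s + 3) * (s + 3 - 1) * x ^ (s + 1))
      have h4 : |((s : ℝ) + 3) * (s + 2) * x ^ (s + 1)| ≤ (s + 3) * (s + 2) * x ^ (s + 2) := by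
        rw [abs_of_nonneg (by positivity)]
        exact mul_le_mul_of_nonneg_left hp2 (by positivity)
      have h5 : C * x ^ s ≤ C * x ^ (s + 2) := mul_le_mul_of_nonneg_left (hp1.trans hp2) hC
      linarith

lemma pow_diff_bounds (p : ℕ) (x : ℝ) (hx : 0 ≤ x) :
    (x + 1) ^ (p + 1) - x ^ (p + 1) ≤ (p + 1) * (x + 1) ^ p ∧
    (p + 1) * x ^ p ≤ (x + 1) ^ (p + 1) - x ^ (p + 1) := by
  induction p with
  | zero => simp
  | succ p ih =>
    obtain ⟨h1, h2⟩ := ih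
    have e : (x + 1) ^ (p + 1 + 1) - x ^ (p + 1 + 1) =
      (x + 1) * ((x + 1) ^ (p + 1) - x ^ (p + 1)) + x ^ (p + 1) := by ring
    have e' : (x + 1) ^ (p + 1 + 1) - x ^ (p + 1 + 1) =
      x * ((x + 1) ^ (p + 1) - x ^ (p + 1)) + (x + 1) ^ (p + 1) := by ring
    have hm : x ^ (p + 1) ≤ (x + 1) ^ (p + 1) := by gcongr; linarith
    push_cast
    constructor
    · rw [e]
      have := mul_le_mul_of_nonneg_left h1 (by linarith : 0 ≤ x + 1)
      have e3 : (x + 1) * ((p + 1) * (x + 1) ^ p) = (p + 1) * (x + 1) ^ (p + 1) := by ring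
      linarith
    · rw [e']
      have := mul_le_mul_of_nonneg_left h2 hx
      have e3 : x * ((p + 1) * x ^ p) = (p + 1) * x ^ (p + 1) := by ring
      linarith

lemma sum_pow_bounds (p M : ℕ) :
    (M : ℝ) ^ (p + 1) ≤ (p + 1) * ∑ k ∈ Finset.Icc 1 M, (k : ℝ) ^ p ∧
    (p + 1) * ∑ k ∈ Finset.Icc 1 M, (k : ℝ) ^ p ≤ ((M : ℝ) + 1) ^ (p + 1) := by
  induction M with
  | zero => simp
  | succ M ih =>
    rw [Finset.sum_Icc_succ_top (by omega)]
    have a1 := pow_diff_bounds p (M : ℝ) (by positivity)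
    have a2 := pow_diff_bounds p ((M : ℝ) + 1) (by positivity)
    push_cast
    constructor
    · linarith [ih.1, a1.1]
    · linarith [ih.2, a2.2]

lemma sum_pow_approx (p M : ℕ) (x : ℝ) (hM : 1 ≤ M) (h1 : (M : ℝ) ≤ x) (h2 : x ≤ M + 1) :
    |∑ k ∈ Finset.Icc 1 M, (k : ℝ) ^ p - x ^ (p + 1) / (p + 1)| ≤ 2 ^ p * x ^ p := by
  have hM' : (1 : ℝ) ≤ M := by exact_mod_cast hM
  have hx : 0 ≤ x := by linarith
  obtain ⟨b1, b2⟩ := sum_pow_bounds p M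
  have a1 := (pow_diff_bounds p (M : ℝ) (by positivity)).1
  have c1 : (M : ℝ) ^ (p + 1) ≤ x ^ (p + 1) := by gcongr
  have c2 : x ^ (p + 1) ≤ ((M : ℝ) + 1) ^ (p + 1) := by gcongr
  have c3 : ((M : ℝ) + 1) ^ p ≤ 2 ^ p * x ^ p := by
    rw [← mul_pow]; gcongr; linarith
  have hp : (0 : ℝ) < p + 1 := by positivity
  set S := ∑ k ∈ Finset.Icc 1 M, (k : ℝ) ^ p
  have e : S - x ^ (p + 1) / (p + 1) = ((p + 1) * S - x ^ (p + 1)) / (p + 1) := by field_simp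
  rw [e, abs_div, abs_of_pos hp, div_le_iff₀ hp]
  have : ((p : ℝ) + 1) * ((M : ℝ) + 1) ^ p ≤ (p + 1) * (2 ^ p * x ^ p) := by gcongr
  rw [abs_le]
  constructor <;> linarith

lemma tsum_tail (f : ℕ → ℝ) (hf0 : ∀ m, 0 ≤ f m) (hf : ∀ m, f m ≤ ((m : ℝ) ^ 2)⁻¹)
    (hf00 : f 0 = 0) (n : ℕ) (S : ℝ) (hS : HasSum f S) :
    |∑ m ∈ Finset.Icc 1 n, f m - S| ≤ 2 / (n + 1) := by
  have e : ∑ m ∈ Finset.Icc 1 n, f m = ∑ m ∈ Finset.range (n + 1), f m := by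
    rw [Finset.range_eq_Ico, Finset.sum_eq_sum_Ico_succ_bot (by omega), hf00, zero_add]
    rfl
  have h1 : ∑ m ∈ Finset.range (n + 1), f m ≤ S := sum_le_hasSum _ (fun i _ => hf0 i) hS
  have h2 : S ≤ ∑ m ∈ Finset.range (n + 1), f m + 2 / (n + 1) := by
    refine le_of_tendsto hS.tendsto_sum_nat ?_
    filter_upwards [Filter.eventually_ge_atTop (n + 1)] with N hN
    rw [← Finset.sum_range_add_sum_Ico f hN]
    have h3 := sum_Ioo_inv_sq_le (α := ℝ) n N
    have h4 : ∑ m ∈ Finset.Ico (n + 1) N, f m ≤ ∑ m ∈ Finset.Ioo n N, ((m : ℝ) ^ 2)⁻¹ :=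
      Finset.sum_le_sum fun m _ => hf m
    linarith
  rw [e, abs_le]
  have : (0 : ℝ) ≤ 2 / (n + 1) := by positivity
  constructor <;> linarith

lemma totient_term_le (r : ℕ) (hr : 3 < r) (m : ℕ) :
    (Nat.totient m : ℝ) / (m : ℝ) ^ (r - 1) ≤ ((m : ℝ) ^ 2)⁻¹ := by
  rcases Nat.eq_zero_or_pos m with rfl | hm
  · simp
  · have hm' : (1 : ℝ) ≤ m := by exact_mod_cast hm
    rw [div_le_iff₀ (by positivity)]
    have h1 : (Nat.totient m : ℝ) ≤ m := by exact_mod_cast Nat.totient_le m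
    have h2 : (m : ℝ) ^ 3 ≤ (m : ℝ) ^ (r - 1) := pow_le_pow_right₀ hm' (by omega)
    calc (Nat.totient m : ℝ) ≤ m := h1
      _ = ((m : ℝ) ^ 2)⁻¹ * (m : ℝ) ^ 3 := by field_simp
      _ ≤ _ := by gcongr

lemma totient_hasSum (r : ℕ) (hr : 3 < r) :
    HasSum (fun m : ℕ => (Nat.totient m : ℝ) / (m : ℝ) ^ (r - 1))
      (riemannZeta ((r : ℂ) - 2) / riemannZeta ((r : ℂ) - 1)).re := by
  have hr' : (3 : ℝ) < r := by exact_mod_cast hr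
  have hre : 1 < ((r : ℂ) - 1).re := by simp; linarith
  have hre2 : 1 < ((r : ℂ) - 2).re := by simp; linarith
  have hterm : ∀ m : ℕ, LSeries.term (fun m => (Nat.totient m : ℂ)) ((r : ℂ) - 1) m =
      (((Nat.totient m : ℝ) / (m : ℝ) ^ (r - 1) : ℝ) : ℂ) := by
    intro m
    rcases eq_or_ne m 0 with rfl | hm
    · simp
    · rw [LSeries.term_of_ne_zero hm]
      have : ((r : ℂ) - 1) = ((r - 1 : ℕ) : ℂ) := by
        rw [Nat.cast_sub (by omega)]; simp
      rw [this, Complex.cpow_natCast]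
      push_cast
      rfl
  have hsumR : Summable (fun m : ℕ => (Nat.totient m : ℝ) / (m : ℝ) ^ (r - 1)) := by
    refine Summable.of_nonneg_of_le (fun m => by positivity) (fun m => ?_)
      (Real.summable_nat_pow_inv.mpr (by norm_num : 1 < 2))
    exact totient_term_le r hr m
  have hsum : LSeriesSummable (fun m => (Nat.totient m : ℂ)) ((r : ℂ) - 1) := by
    unfold LSeriesSummable
    rw [funext hterm]
    exact_mod_cast hsumR
  have hconv : LSeries.convolution (fun m => (Nat.totient m : ℂ)) 1 = fun m : ℕ => (m : ℂ) := by
    funext m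
    rw [LSeries.convolution_def]
    simp only [Pi.one_apply, mul_one]
    rw [Nat.sum_divisorsAntidiagonal (fun i _ => (Nat.totient i : ℂ))]
    rw [← Nat.cast_sum, Nat.sum_totient]
  have hmul := LSeries_convolution' hsum (LSeriesSummable_one_iff.mpr hre)
  rw [hconv, LSeries_one_eq_riemannZeta hre] at hmul
  have hid : LSeries (fun m : ℕ => (m : ℂ)) ((r : ℂ) - 1) = riemannZeta ((r : ℂ) - 2) := by
    rw [← LSeries_one_eq_riemannZeta hre2]
    unfold LSeries
    congr 1
    funext m
    rcases eq_or_ne m 0 with rfl | hm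
    · simp
    · rw [LSeries.term_of_ne_zero hm, LSeries.term_of_ne_zero hm]
      have hm' : (m : ℂ) ≠ 0 := by exact_mod_cast hm
      have : (r : ℂ) - 1 = (r - 2) + 1 := by ring
      rw [this, Complex.cpow_add _ _ hm', Complex.cpow_one]
      simp
      field_simp
  have hz := riemannZeta_ne_zero_of_one_lt_re hre
  rw [hid] at hmul
  rw [hmul, mul_div_cancel_right₀ _ hz]
  have h2 := hsum.LSeriesHasSum
  unfold LSeriesHasSum at h2
  rw [funext hterm] at h2
  have h3 := Complex.hasSum_re h2
  simpa only [Complex.ofReal_re] using h3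

/-- contribution of one direction -/
noncomputable def GF (n r a b : ℕ) : ℕ :=
  ∑ k ∈ Finset.Icc 1 n, (profF r k).card * ((n - k * a) * (n - k * b))

lemma GF_eq (n r a b : ℕ) (ha : 1 ≤ a) (hb : b ≤ a) :
    (GF n r a b : ℝ) = ∑ k ∈ Finset.Icc 1 (n / a),
      ((profF r k).card : ℝ) * (((n : ℝ) - k * a) * (n - k * b)) := by
  have hsub : Finset.Icc 1 (n / a) ⊆ Finset.Icc 1 n :=
    Finset.Icc_subset_Icc le_rfl (Nat.div_le_self _ _)
  rw [GF, ← Finset.sum_subset hsub]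
  · push_cast
    refine Finset.sum_congr rfl fun k hk => ?_
    rw [Finset.mem_Icc] at hk
    have h1 : k * a ≤ n := (Nat.le_div_iff_mul_le (by omega)).mp hk.2
    have h2 : k * b ≤ n := (Nat.mul_le_mul_left k hb).trans h1
    rw [Nat.cast_sub h1, Nat.cast_sub h2]
    push_cast
    ring
  · intro k hk hk2
    rw [Finset.mem_Icc] at hk hk2
    have h1 : n < k * a := by
      by_contra! h
      exact hk2 ⟨hk.1, (Nat.le_div_iff_mul_le (by omega)).mpr h⟩
    rw [Nat.sub_eq_zero_of_le h1.le]
    simp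

lemma GF_approx (r : ℕ) (hr : 3 < r) : ∃ C : ℝ, 0 ≤ C ∧ ∀ n a b : ℕ, 1 ≤ a → a ≤ n → b ≤ a →
    |(GF n r a b : ℝ) - (n : ℝ) ^ (r + 1) / (a : ℝ) ^ (r - 1) *
      (1 - (b : ℝ) / a * (((r : ℝ) - 1) / (r + 1)))| ≤ C * ((n : ℝ) ^ r / (a : ℝ) ^ (r - 2)) := by
  obtain ⟨C, hC, huv⟩ := uv_bound r hr.le
  obtain ⟨p, rfl⟩ := Nat.exists_eq_add_of_le' (show 2 ≤ r by omega)
  refine ⟨C + (p + 2) * (p + 1) * (2 ^ p + 2 ^ (p + 2) + 2 ^ (p + 2)), by positivity, ?_⟩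
  intro n a b ha han hba
  have hM : 1 ≤ n / a := (Nat.le_div_iff_mul_le (by omega)).mpr (by omega)
  have haR : (1 : ℝ) ≤ a := by exact_mod_cast ha
  have hbaR : (b : ℝ) ≤ a := by exact_mod_cast hba
  have ha0 : (0 : ℝ) < a := by linarith
  set x : ℝ := (n : ℝ) / a with hx
  have hnx : (n : ℝ) = a * x := by rw [hx]; field_simp
  have hMx : ((n / a : ℕ) : ℝ) ≤ x := Nat.cast_div_le
  have hxM : x ≤ ((n / a : ℕ) : ℝ) + 1 := by
    rw [hx, div_le_iff₀ ha0]
    have : n < (n / a + 1) * a := by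
      rw [add_mul, one_mul, mul_comm]
      have h1 := Nat.div_add_mod n a
      have h2 := Nat.mod_lt n (show a > 0 by omega)
      omega
    exact_mod_cast this.le
  set M := n / a with hMdef
  have hM1 : (1 : ℝ) ≤ M := by exact_mod_cast hM
  have hx0 : 0 ≤ x := by linarith
  have s0 := sum_pow_approx p M x hM hMx hxM
  have s1 := sum_pow_approx (p + 1) M x hM hMx hxM
  have s2 := sum_pow_approx (p + 2) M x hM hMx hxM
  rw [GF_eq n _ a b ha hba, ← hMdef]
  set e : ℕ → ℝ := fun k => ((profF (p + 2) k).card : ℝ) - (p + 2) * (p + 1) * (k : ℝ) ^ p with he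
  have hsplit : ∑ k ∈ Finset.Icc 1 M,
      ((profF (p + 2) k).card : ℝ) * (((n : ℝ) - k * a) * (n - k * b)) =
      ∑ k ∈ Finset.Icc 1 M, e k * (((n : ℝ) - k * a) * (n - k * b)) +
      (p + 2) * (p + 1) * ((n : ℝ) ^ 2 * ∑ k ∈ Finset.Icc 1 M, (k : ℝ) ^ p
        - n * (a + b) * ∑ k ∈ Finset.Icc 1 M, (k : ℝ) ^ (p + 1)
        + a * b * ∑ k ∈ Finset.Icc 1 M, (k : ℝ) ^ (p + 2)) := by
    simp only [Finset.mul_sum, ← Finset.sum_add_distrib, ← Finset.sum_sub_distrib]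
    refine Finset.sum_congr rfl fun k _ => ?_
    rw [he]; ring
  have herr : |∑ k ∈ Finset.Icc 1 M, e k * (((n : ℝ) - k * a) * (n - k * b))| ≤
      C * ((n : ℝ) ^ 2 * x ^ p) := by
    refine (Finset.abs_sum_le_sum_abs _ _).trans ?_
    have : ∀ k ∈ Finset.Icc 1 M, |e k * (((n : ℝ) - k * a) * (n - k * b))| ≤
        C * x ^ (p - 1) * (n : ℝ) ^ 2 := by
      intro k hk
      rw [Finset.mem_Icc] at hk
      have hk1 : (1 : ℝ) ≤ k := by exact_mod_cast hk.1
      have hkM : (k : ℝ) ≤ M := by exact_mod_cast hk.2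
      have hka : (k : ℝ) * a ≤ n := by
        rw [hnx, mul_comm]; gcongr; linarith
      have hkb : (k : ℝ) * b ≤ n := le_trans (by gcongr) hka
      have hk0 : (0 : ℝ) ≤ k * a := by positivity
      have hk0' : (0 : ℝ) ≤ k * b := by positivity
      rw [abs_mul]
      have h1 : |e k| ≤ C * x ^ (p - 1) := by
        have h := (huv k hk1).1
        have e1 : p + 2 - 2 = p := by omega
        have e2 : p + 2 - 3 = p - 1 := by omega
        rw [e1, e2, ← card_profF _ _ hk.1] at h
        have e3 : ((p + 2 : ℕ) : ℝ) * ((p + 2 : ℕ) - 1) = (p + 2) * (p + 1) := by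
          push_cast; ring
        rw [e3] at h
        refine h.trans ?_
        gcongr
        linarith
      have h2 : |((n : ℝ) - k * a) * (n - k * b)| ≤ (n : ℝ) ^ 2 := by
        rw [abs_of_nonneg (mul_nonneg (by linarith) (by linarith)), sq]
        apply mul_le_mul <;> linarith
      exact mul_le_mul h1 h2 (abs_nonneg _) (by positivity)
    refine (Finset.sum_le_sum this).trans ?_
    rw [Finset.sum_const, Nat.card_Icc, nsmul_eq_mul]
    have e4 : x ^ p = x * x ^ (p - 1) := by rw [← pow_succ']; congr 1; omega
    rw [e4]
    calc ((M + 1 - 1 : ℕ) : ℝ) * (C * x ^ (p - 1) * (n : ℝ) ^ 2)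
        = M * (C * x ^ (p - 1) * (n : ℝ) ^ 2) := by simp
      _ ≤ x * (C * x ^ (p - 1) * (n : ℝ) ^ 2) := by gcongr
      _ = _ := by ring
  rw [hsplit]
  push_cast at s0 s1 s2 ⊢
  generalize ∑ k ∈ Finset.Icc 1 M, e k * (((n : ℝ) - k * a) * (n - k * b)) = E at *
  generalize ∑ k ∈ Finset.Icc 1 M, (k : ℝ) ^ p = S0 at *
  generalize ∑ k ∈ Finset.Icc 1 M, (k : ℝ) ^ (p + 1) = S1 at *
  generalize ∑ k ∈ Finset.Icc 1 M, (k : ℝ) ^ (p + 2) = S2 at *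
  have hT : (n : ℝ) ^ (p + 2) / (a : ℝ) ^ p = (n : ℝ) ^ 2 * x ^ p := by
    rw [hx, div_pow]; ring
  rw [hT]
  have hmain : (n : ℝ) ^ (p + 2 + 1) / (a : ℝ) ^ (p + 1) *
      (1 - (b : ℝ) / a * (((p : ℝ) + 2 - 1) / (p + 2 + 1))) =
      (p + 2) * (p + 1) * ((n : ℝ) ^ 2 * (x ^ (p + 1) / (p + 1))
        - n * (a + b) * (x ^ (p + 1 + 1) / (p + 1 + 1))
        + a * b * (x ^ (p + 2 + 1) / (p + 2 + 1))) := by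
    rw [hnx]
    have h1 : (p : ℝ) + 1 ≠ 0 := by positivity
    have h2 : (p : ℝ) + 2 ≠ 0 := by positivity
    have h3 : (p : ℝ) + 3 ≠ 0 := by positivity
    have h4 : (p : ℝ) + 1 + 1 = p + 2 := by ring
    have h5 : (p : ℝ) + 2 + 1 = p + 3 := by ring
    rw [h4, h5]
    field_simp
    ring
  rw [hmain]
  set d0 := S0 - x ^ (p + 1) / (p + 1)
  set d1 := S1 - x ^ (p + 1 + 1) / (p + 1 + 1)
  set d2 := S2 - x ^ (p + 2 + 1) / (p + 2 + 1)
  have hfin : E + (p + 2) * (p + 1) * ((n : ℝ) ^ 2 * S0 - n * (a + b) * S1 + a * b * S2)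
      - (p + 2) * (p + 1) * ((n : ℝ) ^ 2 * (x ^ (p + 1) / (p + 1))
        - n * (a + b) * (x ^ (p + 1 + 1) / (p + 1 + 1))
        + a * b * (x ^ (p + 2 + 1) / (p + 2 + 1)))
      = E + (p + 2) * (p + 1) * ((n : ℝ) ^ 2 * d0 + (-(n * (a + b) * d1)) + a * b * d2) := by
    simp only [d0, d1, d2]; ring
  rw [hfin]
  have b0 : |(n : ℝ) ^ 2 * d0| ≤ 2 ^ p * ((n : ℝ) ^ 2 * x ^ p) := by
    rw [abs_mul, abs_of_nonneg (by positivity)]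
    calc (n : ℝ) ^ 2 * |d0| ≤ (n : ℝ) ^ 2 * (2 ^ p * x ^ p) := by gcongr
      _ = _ := by ring
  have b1 : |-((n : ℝ) * (a + b) * d1)| ≤ 2 ^ (p + 2) * ((n : ℝ) ^ 2 * x ^ p) := by
    rw [abs_neg, abs_mul, abs_of_nonneg (by positivity)]
    calc (n : ℝ) * (a + b) * |d1| ≤ (n : ℝ) * (a + a) * (2 ^ (p + 1) * x ^ (p + 1)) := by gcongr
      _ = _ := by rw [hnx]; ring
  have b2 : |(a : ℝ) * b * d2| ≤ 2 ^ (p + 2) * ((n : ℝ) ^ 2 * x ^ p) := by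
    rw [abs_mul, abs_of_nonneg (by positivity)]
    calc (a : ℝ) * b * |d2| ≤ (a : ℝ) * a * (2 ^ (p + 2) * x ^ (p + 2)) := by gcongr
      _ = _ := by rw [hnx]; ring
  have b3 : |(n : ℝ) ^ 2 * d0 + (-(n * (a + b) * d1)) + a * b * d2| ≤
      (2 ^ p + 2 ^ (p + 2) + 2 ^ (p + 2)) * ((n : ℝ) ^ 2 * x ^ p) := by
    refine (abs_add_three _ _ _).trans ?_
    linarith
  refine (abs_add_le _ _).trans ?_
  rw [abs_mul ((p + 2 : ℝ) * (p + 1)), abs_of_nonneg (by positivity : (0 : ℝ) ≤ (p + 2) * (p + 1))]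
  have := mul_le_mul_of_nonneg_left b3 (by positivity : (0 : ℝ) ≤ (p + 2) * (p + 1))
  linarith

lemma sum_reflect_const (m : ℕ) (hm : 1 ≤ m) (A κ : ℝ) :
    ∑ b ∈ (Finset.range m).filter m.Coprime,
      (A * (1 - (b : ℝ) / m * κ) + A * (1 - ((m - b : ℕ) : ℝ) / m * κ)) =
      Nat.totient m * (A * (2 - κ)) := by
  have hm0 : (m : ℝ) ≠ 0 := by positivity
  rw [Nat.totient_eq_card_coprime, ← nsmul_eq_mul, ← Finset.sum_const]
  refine Finset.sum_congr rfl fun b hb => ?_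
  have hb' : b < m := by simpa using (Finset.mem_filter.mp hb).1
  rw [Nat.cast_sub hb'.le]
  field_simp
  ring

lemma count_eq_GF (n r : ℕ) (hr : 0 < r) : (collinearCount n r : ℝ) = (n : ℝ) ^ 2 +
    2 * ∑ m ∈ Finset.Icc 1 n, ∑ b ∈ (Finset.range m).filter m.Coprime,
      ((GF n r m b : ℝ) + GF n r m (m - b)) := by
  have h := sum_dirsF n (GF n r) (fun a b => by
    unfold GF
    exact Finset.sum_congr rfl fun k _ => by rw [mul_comm (n - k * a)])
  have h2 := collinearCount_eq n r hr
  have h3 : collinearCount n r = n ^ 2 + ∑ d ∈ dirsF n, GF n r d.1.natAbs d.2.natAbs := h2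
  rw [h3, h]
  push_cast
  rfl

theorem collinear_tuples_count (r : ℕ) (hr : 3 < r) :
    ∃ C : ℝ, 0 < C ∧ ∃ N : ℕ, ∀ n ≥ N,
      |(collinearCount n r : ℝ) -
        2 * ((r : ℝ) + 3) / ((r : ℝ) + 1) *
          (riemannZeta ((r : ℂ) - 2) / riemannZeta ((r : ℂ) - 1)).re * (n : ℝ) ^ (r + 1)| ≤
        C * (n : ℝ) ^ r * Real.log n := by
  obtain ⟨C, hC, hG⟩ := GF_approx r hr
  have hZ := totient_hasSum r hr
  set Z : ℝ := (riemannZeta ((r : ℂ) - 2) / riemannZeta ((r : ℂ) - 1)).re with hZdef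
  refine ⟨9 + 8 * C, by positivity, 3, fun n hn => ?_⟩
  have hr' : (3 : ℝ) < r := by exact_mod_cast hr
  have hn3 : (3 : ℝ) ≤ n := by exact_mod_cast hn
  have hlog : 1 ≤ Real.log n := by
    rw [Real.le_log_iff_exp_le (by linarith)]
    linarith [Real.exp_one_lt_three]
  set κ : ℝ := ((r : ℝ) - 1) / (r + 1) with hκ
  have hκ0 : 0 ≤ κ := div_nonneg (by linarith) (by linarith)
  have hκ2 : 2 - κ = ((r : ℝ) + 3) / (r + 1) := by
    rw [hκ]
    have : (r : ℝ) + 1 ≠ 0 := by positivity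
    field_simp
    ring
  have hκpos : 0 ≤ 2 - κ := by rw [hκ2]; positivity
  -- one value of `m`
  have hm : ∀ m ∈ Finset.Icc 1 n, |∑ b ∈ (Finset.range m).filter m.Coprime,
      ((GF n r m b : ℝ) + GF n r m (m - b)) -
      (n : ℝ) ^ (r + 1) * (2 - κ) * ((Nat.totient m : ℝ) / (m : ℝ) ^ (r - 1))| ≤
      2 * C * (n : ℝ) ^ r * (m : ℝ)⁻¹ := by
    intro m hm
    rw [Finset.mem_Icc] at hm
    have hm1 : (1 : ℝ) ≤ m := by exact_mod_cast hm.1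
    have e : (n : ℝ) ^ (r + 1) * (2 - κ) * ((Nat.totient m : ℝ) / (m : ℝ) ^ (r - 1)) =
        Nat.totient m * ((n : ℝ) ^ (r + 1) / (m : ℝ) ^ (r - 1) * (2 - κ)) := by ring
    rw [e, ← sum_reflect_const m hm.1, ← Finset.sum_sub_distrib]
    refine (Finset.abs_sum_le_sum_abs _ _).trans ?_
    have hb : ∀ b ∈ (Finset.range m).filter m.Coprime,
        |(GF n r m b : ℝ) + GF n r m (m - b) -
          ((n : ℝ) ^ (r + 1) / (m : ℝ) ^ (r - 1) * (1 - (b : ℝ) / m * κ) +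
          (n : ℝ) ^ (r + 1) / (m : ℝ) ^ (r - 1) * (1 - ((m - b : ℕ) : ℝ) / m * κ))| ≤
        2 * C * ((n : ℝ) ^ r / (m : ℝ) ^ (r - 2)) := by
      intro b hb
      have hb' : b < m := by simpa using (Finset.mem_filter.mp hb).1
      have h1 := hG n m b hm.1 hm.2 hb'.le
      have h2 := hG n m (m - b) hm.1 hm.2 (Nat.sub_le _ _)
      rw [add_sub_add_comm]
      refine (abs_add_le _ _).trans ?_
      linarith
    refine (Finset.sum_le_sum hb).trans ?_
    rw [Finset.sum_const, nsmul_eq_mul, ← Nat.totient_eq_card_coprime]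
    have h1 : (Nat.totient m : ℝ) ≤ m := by exact_mod_cast Nat.totient_le m
    have h2 : (m : ℝ) ^ 2 ≤ (m : ℝ) ^ (r - 2) := pow_le_pow_right₀ hm1 (by omega)
    calc (Nat.totient m : ℝ) * (2 * C * ((n : ℝ) ^ r / (m : ℝ) ^ (r - 2)))
        ≤ m * (2 * C * ((n : ℝ) ^ r / (m : ℝ) ^ 2)) := by gcongr
      _ = _ := by field_simp
  have hsum : |∑ m ∈ Finset.Icc 1 n, ∑ b ∈ (Finset.range m).filter m.Coprime,
      ((GF n r m b : ℝ) + GF n r m (m - b)) - (n : ℝ) ^ (r + 1) * (2 - κ) *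
        ∑ m ∈ Finset.Icc 1 n, (Nat.totient m : ℝ) / (m : ℝ) ^ (r - 1)| ≤
      2 * C * (n : ℝ) ^ r * (1 + Real.log n) := by
    rw [Finset.mul_sum, ← Finset.sum_sub_distrib]
    refine (Finset.abs_sum_le_sum_abs _ _).trans ((Finset.sum_le_sum hm).trans ?_)
    rw [← Finset.mul_sum]
    have h1 := harmonic_le_one_add_log n
    rw [harmonic_eq_sum_Icc] at h1
    push_cast at h1
    gcongr
  have htail := tsum_tail _ (fun m => by positivity) (totient_term_le r hr) (by simp) n Z hZ
  rw [count_eq_GF n r (by omega)]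
  set T := ∑ m ∈ Finset.Icc 1 n, ∑ b ∈ (Finset.range m).filter m.Coprime,
      ((GF n r m b : ℝ) + GF n r m (m - b))
  set P := ∑ m ∈ Finset.Icc 1 n, (Nat.totient m : ℝ) / (m : ℝ) ^ (r - 1)
  have e1 : (n : ℝ) ^ 2 + 2 * T - 2 * ((r : ℝ) + 3) / ((r : ℝ) + 1) * Z * (n : ℝ) ^ (r + 1) =
      (n : ℝ) ^ 2 + 2 * (T - (n : ℝ) ^ (r + 1) * (2 - κ) * P) +
        2 * (2 - κ) * (n : ℝ) ^ (r + 1) * (P - Z) := by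
    rw [hκ2]; ring
  rw [e1]
  refine (abs_add_three _ _ _).trans ?_
  have hnr : (0 : ℝ) ≤ (n : ℝ) ^ r := by positivity
  have b1 : |(n : ℝ) ^ 2| ≤ (n : ℝ) ^ r := by
    rw [abs_of_nonneg (by positivity)]
    exact pow_le_pow_right₀ (by linarith) (by omega)
  have b2 : |2 * (T - (n : ℝ) ^ (r + 1) * (2 - κ) * P)| ≤
      4 * C * (n : ℝ) ^ r * (1 + Real.log n) := by
    rw [abs_mul, abs_two]; linarith
  have b3 : |2 * (2 - κ) * (n : ℝ) ^ (r + 1) * (P - Z)| ≤ 8 * (n : ℝ) ^ r := by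
    rw [abs_mul, abs_of_nonneg (by positivity)]
    calc 2 * (2 - κ) * (n : ℝ) ^ (r + 1) * |P - Z|
        ≤ 2 * (2 - 0) * (n : ℝ) ^ (r + 1) * (2 / (n + 1)) := by gcongr
      _ = 8 * (n : ℝ) ^ r * (n / (n + 1)) := by ring
      _ ≤ 8 * (n : ℝ) ^ r * 1 := by
        gcongr
        rw [div_le_one (by positivity)]
        linarith
      _ = _ := by ring
  have b4 : (n : ℝ) ^ r ≤ (n : ℝ) ^ r * Real.log n := le_mul_of_one_le_right hnr hlog
  have b5 : C * (n : ℝ) ^ r ≤ C * ((n : ℝ) ^ r * Real.log n) := mul_le_mul_of_nonneg_left b4 hC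
  nlinarith
end
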